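/- In the good-path setting, there exist q ∈ (0, p) and M_q ∈ (1, ∞) such that for every L > 1 and every ζ ∈ B_L: (i) sup_{t∈[0,L]} ⟨1, ζ(t)⟩ ∨ ⟨χ, ζ(t)⟩ ∨ ⟨χ^{1+q}, ζ(t)⟩ ≤ M_q; (ii) the function t ↦ ⟨χ, ζ(t)⟩ is constant on [0,L]; (iii) ζ is a fluid model solution on [0,L] for the critical data (α, ν). -/

import Mathlib

open MeasureTheory Filter Set
noncomputable section
namespace PSQ

/-- ⟨g, ζ⟩ = ∫ g dζ -/
def pair (g : ℝ → ℝ) (ζ : Measure ℝ) : ℝ := ∫ x, g x ∂ζ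

/-- total mass ⟨1, ζ⟩ of a finite measure, as a real number -/
def mass (ζ : Measure ℝ) : ℝ := (ζ Set.univ).toReal

/-- truncated Dirac measure δ⁺ₓ -/
def dplus (x : ℝ) : Measure ℝ := if 0 < x then Measure.dirac x else 0

/-- positive part x⁺ -/
def pos (x : ℝ) : ℝ := max x 0

/-- the arrival counting process E(t) = sup{i : U i ≤ t} -/
def Ecount (U : ℕ → ℝ) (t : ℝ) : ℕ := sSup {i : ℕ | U i ≤ t}

/-- the standing hypotheses on the data of a pathwise processor sharing queue:
nondecreasing arrival times with `U 0 = 0`, `U 1 > 0`, `U i → ∞`, and strictly positive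
service times and initial service times. -/
def QueueHyps (U v : ℕ → ℝ) (Z0 : ℕ) (vt : ℕ → ℝ) : Prop :=
  U 0 = 0 ∧ Monotone U ∧ 0 < U 1 ∧ Tendsto U atTop atTop ∧
    (∀ i, 1 ≤ i → 0 < v i) ∧ (∀ j, 1 ≤ j → 0 < vt j)

/-- the defining equations of the state descriptor μ and the cumulative service per
job S:  `S t = ∫_0^t φ(⟨1, μ(s)⟩) ds` (recall `(0:ℝ)⁻¹ = 0` in Lean, matching φ(0)=0)
and `μ(t) = Σ_j δ⁺_{(ṽ_j - S(t))⁺} + Σ_{i ≤ E(t)} δ⁺_{(v_i - S(t) + S(U_i))⁺}`. -/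
def StateEqns (U v : ℕ → ℝ) (Z0 : ℕ) (vt : ℕ → ℝ)
    (μ : ℝ → Measure ℝ) (S : ℝ → ℝ) : Prop :=
  ∀ t, 0 ≤ t →
    (S t = ∫ s in (0:ℝ)..t, (mass (μ s))⁻¹) ∧
    μ t = (∑ j ∈ Finset.range Z0, dplus (pos (vt (j+1) - S t)))
        + ∑ i ∈ Finset.range (Ecount U t), dplus (pos (v (i+1) - S t + S (U (i+1))))

/-- fluid scaled state descriptor μ̄^r(t) = r⁻¹ μ(rt) -/
def fmu (μ : ℝ → Measure ℝ) (r t : ℝ) : Measure ℝ := ENNReal.ofReal (1/r) • μ (r*t)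

/-- fluid scaled arrival process Ē^r(t) = r⁻¹ E(rt) -/
def fE (U : ℕ → ℝ) (r t : ℝ) : ℝ := (Ecount U (r*t) : ℝ) / r

/-- fluid scaled cumulative service S̄^r_{t,t'} = S(r t') - S(r t) -/
def fS (S : ℝ → ℝ) (r t t' : ℝ) : ℝ := S (r*t') - S (r*t)

end PSQ
end

namespace PSQ

/-- The constraints tying together the constants of the good-path properties:
`ε ∈ (0,1)`, `l, p, κ, γ > 0`, `M > 1`, `l < ε/(32α)`, `κ < l/(2M)`,
`γ < (κε/4) ∧ (l/4)`. -/
def GoodConsts (α ε l p κ γ M : ℝ) : Prop :=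
  ε ∈ Set.Ioo (0:ℝ) 1 ∧ 0 < l ∧ 0 < p ∧ 0 < κ ∧ 0 < γ ∧ 1 < M ∧
    l < ε/(32*α) ∧ κ < l/(2*M) ∧ γ < min (κ*ε/4) (l/4)

/-- A processor sharing path satisfies the level-(ε, l, κ, γ, M) good-path properties
(for r, T, L), with `N = ⌈64M²/(κε²)⌉ + 1`. -/
def GoodPath (U v : ℕ → ℝ) (μ : ℝ → Measure ℝ) (ν : Measure ℝ)
    (T L r ε l p κ γ M : ℝ) : Prop :=
  ∀ m : ℕ, m ≤ ⌊r * T⌋₊ →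
    (∀ t ∈ Set.Icc (0:ℝ) L, fE U r ((m:ℝ) + t + l) - fE U r ((m:ℝ) + t) ≤ ε/16) ∧
    (∀ t ∈ Set.Icc (0:ℝ) L,
      max (max (mass (fmu μ r ((m:ℝ)+t))) (pair id (fmu μ r ((m:ℝ)+t))))
        (pair (fun x => x ^ ((1:ℝ)+p)) (fmu μ r ((m:ℝ)+t))) ≤ M) ∧
    (∀ x : ℝ, 0 ≤ x → ((fmu μ r 0) (Set.Icc x (x+κ))).toReal ≤ ε/4) ∧
    (∀ t ∈ Set.Icc (0:ℝ) L,
      |pair id (fmu μ r ((m:ℝ)+t)) - pair id (fmu μ r (m:ℝ))| ≤ γ/4) ∧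
    (∀ t ∈ Set.Icc (0:ℝ) L, ∀ k : ℕ, k ≤ ⌈64*M^2/(κ*ε^2)⌉₊ + 1 →
      (1/r) * (∑ i ∈ Finset.Ioc (Ecount U (r*((m:ℝ)+t))) (Ecount U (r*((m:ℝ)+t+l))),
          if (k:ℝ)*κ ≤ v i ∧ v i < ((k:ℝ)+1)*κ then (1:ℝ) else 0)
        ≤ (ε/8) * (ν (Set.Ico (((k:ℝ)-1/2)*κ) (((k:ℝ)+3/2)*κ))).toReal)

end PSQ

namespace PSQ

/-- the metric d on finite measures built from the families (g_k), (h_k)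
(with 0-based indexing, so `g k` plays the role of the paper's `g_{k+1}`). -/
noncomputable def dmet (g h : ℕ → ℝ → ℝ) (ζ₁ ζ₂ : Measure ℝ) : ℝ :=
  (∑' k : ℕ, (2:ℝ)⁻¹^(k+1) * min |pair (g k) ζ₁ - pair (g k) ζ₂| 1)
    + ⨆ k : ℕ, |pair (h k) ζ₁ - pair (h k) ζ₂|

/-- the hypotheses on the families (g_k), (h_k) defining the metric d (0-based
indexing: `h k` vanishes on [0,k] and equals 1 on [k+1,∞), i.e. it is the paper's
`h_{k+1}`); the family (g_k) is convergence determining for weak convergence of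
finite Borel measures on ℝ₊. -/
def MetricFamilies (g h : ℕ → ℝ → ℝ) : Prop :=
  (∀ k, (∀ x, 0 ≤ g k x ∧ g k x ≤ 1) ∧ ContDiff ℝ 1 (g k) ∧ ∃ C, ∀ x, |deriv (g k) x| ≤ C) ∧
  (∀ k, (∀ x, 0 ≤ h k x ∧ h k x ≤ 1) ∧ ContDiff ℝ 1 (h k) ∧
    (∀ x ∈ Set.Icc (0:ℝ) (k:ℝ), h k x = 0) ∧ (∀ x, (k:ℝ)+1 ≤ x → h k x = 1) ∧
    (∀ x, |deriv (h k) x| ≤ 2)) ∧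
  (∀ (ζs : ℕ → Measure ℝ) (ζ : Measure ℝ),
    (∀ j, IsFiniteMeasure (ζs j)) → IsFiniteMeasure ζ →
    (∀ j, ζs j (Set.Iio 0) = 0) → ζ (Set.Iio 0) = 0 →
    (∀ k, Tendsto (fun j => pair (g k) (ζs j)) atTop (nhds (pair (g k) ζ))) →
    ∀ f : ℝ → ℝ, Continuous f → (∃ C, ∀ x, |f x| ≤ C) →
      Tendsto (fun j => pair f (ζs j)) atTop (nhds (pair f ζ)))

end PSQ

namespace PSQ

/-- the excess lifetime distribution ν_e associated with ν:
it has density y ↦ β·ν((y,∞)) on [0,∞) with β = (∫x dν)⁻¹, so that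
ν_e([0,x]) = β ∫_0^x ν((y,∞)) dy. -/
noncomputable def nue (ν : Measure ℝ) : Measure ℝ :=
  (volume.restrict (Set.Ici (0:ℝ))).withDensity
    fun y => ν (Set.Ioi y) * (ENNReal.ofReal (∫ x, x ∂ν))⁻¹

/-- the lifting map Δ: w ↦ (w/⟨χ,νe⟩)·νe -/
noncomputable def Delta (νe : Measure ℝ) (w : ℝ) : Measure ℝ :=
  ENNReal.ofReal (w / ∫ x, x ∂νe) • νe

/-- sums of g(v_i) over arrivals i with s < U_i-index ≤ t,
i.e. Σ_{i = E(s)+1}^{E(t)} g(v_i). -/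
noncomputable def arrSum (U w : ℕ → ℝ) (g : ℝ → ℝ) (s t : ℝ) : ℝ :=
  ∑ i ∈ Finset.Ioc (Ecount U s) (Ecount U t), g (w i)

/-- weak continuity of a measure-valued path on a set -/
def WeaklyContinuousOn (ζ : ℝ → Measure ℝ) (s : Set ℝ) : Prop :=
  ∀ f : ℝ → ℝ, Continuous f → (∃ C, ∀ x, |f x| ≤ C) →
    ContinuousOn (fun t => pair f (ζ t)) s

/-- fluid model solution on [0,L] for critical data (α, ν) -/
def IsFluidSol (α : ℝ) (ν : Measure ℝ) (L : ℝ) (ζ : ℝ → Measure ℝ) : Prop :=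
  (∀ t ∈ Set.Icc (0:ℝ) L, IsFiniteMeasure (ζ t) ∧ ζ t (Set.Iio 0) = 0 ∧ ζ t {0} = 0) ∧
  WeaklyContinuousOn ζ (Set.Icc 0 L) ∧
  ((ζ 0 = 0 ∧ ∀ t ∈ Set.Icc (0:ℝ) L, ζ t = 0) ∨
   ((∀ t ∈ Set.Icc (0:ℝ) L, ζ t ≠ 0) ∧
    ∀ t ∈ Set.Icc (0:ℝ) L, ∀ gf : ℝ → ℝ, ContDiff ℝ 1 gf →
      (∃ C, ∀ x, |gf x| ≤ C ∧ |deriv gf x| ≤ C) → gf 0 = 0 → deriv gf 0 = 0 →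
      pair gf (ζ t) = pair gf (ζ 0)
        - (∫ s in (0:ℝ)..t, pair (deriv gf) (ζ s) / mass (ζ s)) + α * t * pair gf ν))

/-- The good-path setting: all the fixed data (heavy traffic sequence R, threshold
sequences ε_n, l_n, κ_n, γ_n, constants p, M, a dense family V of test functions, the
families g, h defining the metric d, the sequence r_n) together with their standing
hypotheses. -/
structure Setting where
  α : ℝ
  ν : Measure ℝ
  T : ℝ
  R : ℕ → ℝ
  εseq : ℕ → ℝ
  lseq : ℕ → ℝ
  κseq : ℕ → ℝ
  γseq : ℕ → ℝ
  p : ℝ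
  M : ℝ
  V : ℕ → ℝ → ℝ
  gmet : ℕ → ℝ → ℝ
  hmet : ℕ → ℝ → ℝ
  rseq : ℕ → ℝ
  hα : 0 < α
  hν : IsProbabilityMeasure ν
  hν0 : ν {0} = 0
  hνsupp : ν (Set.Iio 0) = 0
  hνint : Integrable (fun x => x) ν
  hcrit : α * ∫ x, x ∂ν = 1
  hT : 1 < T
  hR : ∀ n, 0 < R n
  hRmono : StrictMono R
  hRtop : Tendsto R atTop atTop
  hε : ∀ n, εseq n ∈ Set.Ioo (0:ℝ) 1
  hεanti : StrictAnti εseq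
  hεlim : Tendsto εseq atTop (nhds 0)
  hp : 0 < p
  hM : 1 < M
  hl : ∀ n, 0 < lseq n
  hκ : ∀ n, 0 < κseq n
  hγ : ∀ n, 0 < γseq n
  hlε : ∀ n, lseq n < εseq n/(32*α)
  hκl : ∀ n, κseq n < lseq n/(2*M)
  hγc : ∀ n, γseq n < min (κseq n * εseq n/4) (lseq n/4)
  hVsupp : ∀ k, HasCompactSupport (V k)
  hVdiff : ∀ k, ContDiff ℝ 1 (V k)
  hV0 : ∀ k, V k 0 = 0 ∧ deriv (V k) 0 = 0
  hVdense : ∀ g : ℝ → ℝ, HasCompactSupport g → ContDiff ℝ 1 g →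
    g 0 = 0 → deriv g 0 = 0 →
    ∃ φ : ℕ → ℕ, (∃ C, ∀ j x, |V (φ j) x| ≤ C ∧ |deriv (V (φ j)) x| ≤ C) ∧
      (∀ x, Tendsto (fun j => V (φ j) x) atTop (nhds (g x))) ∧
      (∀ x, Tendsto (fun j => deriv (V (φ j)) x) atTop (nhds (deriv g x)))
  hmetfam : MetricFamilies gmet hmet
  hrpos : ∀ n, 0 < rseq n
  hrmono : StrictMono rseq
  hrtop : Tendsto rseq atTop atTop

/-- the excess lifetime distribution of the setting -/
noncomputable def Setting.nuE (S : Setting) : Measure ℝ := nue S.ν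

/-- the index n(r) -/
noncomputable def Setting.nIdx (S : Setting) (r : ℝ) : ℕ := sSup {n : ℕ | S.rseq n < r}

/-- membership in the invariant manifold M_ν -/
def Setting.onManifold (S : Setting) (ξ : Measure ℝ) : Prop :=
  ∃ c : ℝ, 0 ≤ c ∧ ξ = ENNReal.ofReal c • S.nuE

/-- the distance of a measure-valued path on [0,L] to the good paths B_L^r :
ζ ∈ B_L^r iff ζ agrees on [0,L] with some shifted fluid scaled state descriptor
μ̄^{r,m}, 0 ≤ m ≤ ⌊rT⌋, of a processor-sharing path satisfying, for all n' ≤ n(r),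
the level-(ε_{n'}, l_{n'}, κ_{n'}, γ_{n'}, M) good-path properties, the law of large
numbers bounds for the test family V, and whose initial measure is ε_{n'}-close to
the invariant manifold. -/
def Setting.memBLr (S : Setting) (L r : ℝ) (ζ : ℝ → Measure ℝ) : Prop :=
  ∃ (U v : ℕ → ℝ) (Z0 : ℕ) (vt : ℕ → ℝ) (μ : ℝ → Measure ℝ) (Sf : ℝ → ℝ) (m : ℕ),
    QueueHyps U v Z0 vt ∧ StateEqns U v Z0 vt μ Sf ∧ m ≤ ⌊r * S.T⌋₊ ∧
    (∀ t ∈ Set.Icc (0:ℝ) L, ζ t = fmu μ r ((m:ℝ)+t)) ∧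
    ∀ n' : ℕ, n' ≤ S.nIdx r →
      GoodPath U v μ S.ν S.T L r (S.εseq n') (S.lseq n') S.p (S.κseq n') (S.γseq n') S.M ∧
      (∀ k : ℕ, k ≤ n' → ∀ j : ℕ, 1 ≤ j → j ≤ ⌊L / S.lseq n'⌋₊ → ∀ m' : ℕ, m' ≤ ⌊r*S.T⌋₊ →
        |(1/r) * arrSum U v (S.V k) (r*(m':ℝ)) (r*((m':ℝ) + (j:ℝ) * S.lseq n'))
          - S.α * (j:ℝ) * S.lseq n' * pair (S.V k) S.ν| ≤ S.εseq n') ∧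
      (∃ ξ : Measure ℝ, S.onManifold ξ ∧
        max (dmet S.gmet S.hmet (fmu μ r 0) ξ) |pair id (fmu μ r 0) - pair id ξ| < S.εseq n')

/-- the set B_L of uniform limits of good paths: weakly continuous M_F-valued paths
on [0,L] that are uniform (in the metric d) limits of paths ζ^j ∈ B_L^{r̃_j} along a
subsequence r̃_j → ∞ of R. -/
def Setting.memBL (S : Setting) (L : ℝ) (ζ : ℝ → Measure ℝ) : Prop :=
  (∀ t ∈ Set.Icc (0:ℝ) L, IsFiniteMeasure (ζ t) ∧ ζ t (Set.Iio 0) = 0) ∧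
  (∀ t ∈ Set.Icc (0:ℝ) L, ∀ ε : ℝ, 0 < ε → ∃ δ : ℝ, 0 < δ ∧
    ∀ s ∈ Set.Icc (0:ℝ) L, |s - t| < δ → dmet S.gmet S.hmet (ζ s) (ζ t) < ε) ∧
  ∃ (φ : ℕ → ℕ) (ζs : ℕ → ℝ → Measure ℝ), StrictMono φ ∧
    (∀ j, S.memBLr L (S.R (φ j)) (ζs j)) ∧
    ∀ ε : ℝ, 0 < ε → ∃ J : ℕ, ∀ j, J ≤ j → ∀ t ∈ Set.Icc (0:ℝ) L,
      dmet S.gmet S.hmet (ζs j t) (ζ t) ≤ ε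

end PSQ

namespace PSQ

/-! ### Finite job systems in processor sharing -/

/-- The sum of `f` over the positive residual service times, at time `t`, of the jobs `i < n`
that arrive at time `A i` with service time `V i`, when `S` is the cumulative service per job. -/
noncomputable def load (n : ℕ) (A V : ℕ → ℝ) (S : ℝ → ℝ) (f : ℝ → ℝ) (t : ℝ) : ℝ :=
  ∑ i ∈ Finset.range n,
    if A i ≤ t ∧ S t < V i + S (A i) then f (V i + S (A i) - S t) else 0

/-- The sum of `f` over the service times of the jobs arriving in `(a, b]`. -/
noncomputable def inflow (n : ℕ) (A V : ℕ → ℝ) (f : ℝ → ℝ) (a b : ℝ) : ℝ :=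
  ∑ i ∈ Finset.range n, if a < A i ∧ A i ≤ b then f (V i) else 0

/-- A processor-sharing system with finitely many jobs, observed on `[0, τ]`. -/
structure JobSys (n : ℕ) (A V : ℕ → ℝ) (S : ℝ → ℝ) (τ : ℝ) : Prop where
  A_nonneg : ∀ i, 0 ≤ A i
  V_pos : ∀ i, 0 < V i
  S_eq : ∀ t, 0 ≤ t → t ≤ τ → S t = ∫ s in (0:ℝ)..t, (load n A V S (fun _ => 1) s)⁻¹

section

variable {n : ℕ} {A V : ℕ → ℝ} {S : ℝ → ℝ} {τ : ℝ}

lemma abs_load_le {f : ℝ → ℝ} {C : ℝ} (h : ∀ x, |f x| ≤ C) (t : ℝ) :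
    |load n A V S f t| ≤ C * load n A V S (fun _ => 1) t := by
  refine (Finset.abs_sum_le_sum_abs _ _).trans ?_
  rw [load, Finset.mul_sum]
  refine Finset.sum_le_sum fun i _ => ?_
  split_ifs with hi
  · simpa using h _
  · simp

lemma abs_inflow_le {f : ℝ → ℝ} {C : ℝ} (h : ∀ x, |f x| ≤ C) (a b : ℝ) :
    |inflow n A V f a b| ≤ C * inflow n A V (fun _ => 1) a b := by
  refine (Finset.abs_sum_le_sum_abs _ _).trans ?_
  rw [inflow, Finset.mul_sum]
  refine Finset.sum_le_sum fun i _ => ?_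
  split_ifs with hi
  · simpa using h _
  · simp

lemma inflow_one_mono {a b c : ℝ} (h : b ≤ c) :
    inflow n A V (fun _ => 1) a b ≤ inflow n A V (fun _ => 1) a c := by
  refine Finset.sum_le_sum fun i _ => ?_
  split_ifs with h1 h2 h2
  · exact le_rfl
  · exact absurd ⟨h1.1, h1.2.trans h⟩ h2
  · exact zero_le_one
  · exact le_rfl

lemma inflow_one_mono_left {a b c : ℝ} (h : a ≤ b) :
    inflow n A V (fun _ => 1) b c ≤ inflow n A V (fun _ => 1) a c := by
  refine Finset.sum_le_sum fun i _ => ?_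
  split_ifs with h1 h2 h2
  · exact le_rfl
  · exact absurd ⟨h.trans_lt h1.1, h1.2⟩ h2
  · exact zero_le_one
  · exact le_rfl

lemma inflow_add (f : ℝ → ℝ) {a b c : ℝ} (hab : a ≤ b) (hbc : b ≤ c) :
    inflow n A V f a b + inflow n A V f b c = inflow n A V f a c := by
  rw [inflow, inflow, inflow, ← Finset.sum_add_distrib]
  refine Finset.sum_congr rfl fun i _ => ?_
  rcases le_or_gt (A i) b with h | h
  · have h1 : ¬ (b < A i ∧ A i ≤ c) := fun h' => absurd h'.1 (not_lt.2 h)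
    have h2 : (a < A i ∧ A i ≤ c) ↔ (a < A i ∧ A i ≤ b) :=
      ⟨fun h' => ⟨h'.1, h⟩, fun h' => ⟨h'.1, h.trans hbc⟩⟩
    simp [h1, h2]
  · have h1 : ¬ (a < A i ∧ A i ≤ b) := fun h' => absurd h'.2 (not_le.2 h)
    have h2 : (a < A i ∧ A i ≤ c) ↔ (b < A i ∧ A i ≤ c) :=
      ⟨fun h' => ⟨h, h'.2⟩, fun h' => ⟨hab.trans_lt h, h'.2⟩⟩
    simp [h1, h2]

lemma load_one_eq (t : ℝ) : load n A V S (fun _ => 1) t =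
    (((Finset.range n).filter fun i => A i ≤ t ∧ S t < V i + S (A i)).card : ℝ) := by
  simp [load, Finset.sum_boole]

lemma inv_load_one_mem (t : ℝ) : (load n A V S (fun _ => 1) t)⁻¹ ∈ Set.Icc (0:ℝ) 1 := by
  rw [load_one_eq]
  exact ⟨by positivity, Nat.cast_inv_le_one _⟩

lemma aemeasurable_load {f : ℝ → ℝ} (hf : Measurable f) {ρ : Measure ℝ} (hS : AEMeasurable S ρ) :
    AEMeasurable (load n A V S f) ρ := by
  have hF : Measurable fun q : ℝ × ℝ => ∑ i ∈ Finset.range n,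
      if A i ≤ q.1 ∧ q.2 < V i + S (A i) then f (V i + S (A i) - q.2) else 0 := by
    refine Finset.measurable_sum _ fun i _ => Measurable.ite ?_ ?_ measurable_const
    · exact (measurableSet_le measurable_const measurable_fst).inter
        (measurableSet_lt measurable_snd measurable_const)
    · exact hf.comp (measurable_const.sub measurable_snd)
  exact hF.comp_aemeasurable (aemeasurable_id.prodMk hS)

namespace JobSys

variable (h : JobSys n A V S τ)
include h

lemma aemeasurable_S : AEMeasurable S (volume.restrict (Set.Icc 0 τ)) := by
  set c : ℝ → ℝ := fun s => (load n A V S (fun _ => 1) s)⁻¹ with hc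
  set J : Set ℝ := {t | t ∈ Set.Icc 0 τ ∧ IntervalIntegrable c volume 0 t} with hJ
  have hJo : J.OrdConnected := by
    refine ⟨fun x hx y hy z hz => ⟨⟨hx.1.1.trans hz.1, hz.2.trans hy.1.2⟩, ?_⟩⟩
    refine hy.2.mono_set ?_
    rw [Set.uIcc_of_le (hx.1.1.trans hz.1), Set.uIcc_of_le hy.1.1]
    exact Set.Icc_subset_Icc_right hz.2
  have hJm : MeasurableSet J := hJo.measurableSet
  have hmono : MonotoneOn S J := by
    intro x hx y hy hxy
    rw [h.S_eq x hx.1.1 hx.1.2, h.S_eq y hy.1.1 hy.1.2]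
    refine intervalIntegral.integral_mono_interval le_rfl hx.1.1 hxy ?_ hy.2
    exact Filter.Eventually.of_forall fun s => (inv_load_one_mem s).1
  have h1 : AEMeasurable S (volume.restrict J) := aemeasurable_restrict_of_monotoneOn hJm hmono
  have h2 : AEMeasurable S (volume.restrict (Set.Icc 0 τ \ J)) := by
    refine (aemeasurable_const (b := (0:ℝ))).congr ?_
    filter_upwards [ae_restrict_mem (measurableSet_Icc.diff hJm)] with x hx
    have : ¬ IntervalIntegrable c volume 0 x := fun h' => hx.2 ⟨hx.1, h'⟩
    rw [h.S_eq x hx.1.1 hx.1.2, intervalIntegral.integral_undef this]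
  have h3 : Set.Icc 0 τ ⊆ J ∪ (Set.Icc 0 τ \ J) := by
    intro x hx
    by_cases hxJ : x ∈ J
    · exact Or.inl hxJ
    · exact Or.inr ⟨hx, hxJ⟩
  exact (aemeasurable_union_iff.2 ⟨h1, h2⟩).mono_measure (Measure.restrict_mono h3 le_rfl)

lemma aemeasurable_load {f : ℝ → ℝ} (hf : Measurable f) :
    AEMeasurable (load n A V S f) (volume.restrict (Set.Icc 0 τ)) :=
  PSQ.aemeasurable_load hf h.aemeasurable_S

lemma intervalIntegrable_mul {f : ℝ → ℝ} (hf : Measurable f) {C : ℝ} (hC : ∀ x, |f x| ≤ C)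
    {a b : ℝ} (ha : 0 ≤ a) (hab : a ≤ b) (hb : b ≤ τ) :
    IntervalIntegrable
      (fun s => load n A V S f s * (load n A V S (fun _ => 1) s)⁻¹) volume a b := by
  have hsub : Set.Ioc a b ⊆ Set.Icc 0 τ := fun x hx => ⟨ha.trans hx.1.le, hx.2.trans hb⟩
  rw [intervalIntegrable_iff_integrableOn_Ioc_of_le hab]
  refine IntegrableOn.of_bound (C := C) (by simp) ?_ ?_
  · exact (((h.aemeasurable_load hf).mul
      (h.aemeasurable_load measurable_const).inv).mono_measure
        (Measure.restrict_mono hsub le_rfl)).aestronglyMeasurable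
  · refine Filter.Eventually.of_forall fun s => ?_
    have h1 := abs_load_le (n := n) (A := A) (V := V) (S := S) hC s
    have h2 := inv_load_one_mem (n := n) (A := A) (V := V) (S := S) s
    have hC0 : 0 ≤ C := (abs_nonneg _).trans (hC 0)
    rw [Real.norm_eq_abs, abs_mul, abs_of_nonneg h2.1]
    rcases eq_or_ne (load n A V S (fun _ => 1) s) 0 with h0 | h0
    · simp [h0, hC0]
    · calc _ ≤ C * load n A V S (fun _ => 1) s * (load n A V S (fun _ => 1) s)⁻¹ :=
            mul_le_mul_of_nonneg_right h1 h2.1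
        _ = C := by field_simp

lemma intervalIntegrable_inv {a b : ℝ} (ha : 0 ≤ a) (hab : a ≤ b) (hb : b ≤ τ) :
    IntervalIntegrable (fun s => (load n A V S (fun _ => 1) s)⁻¹) volume a b := by
  have hsub : Set.Ioc a b ⊆ Set.Icc 0 τ := fun x hx => ⟨ha.trans hx.1.le, hx.2.trans hb⟩
  rw [intervalIntegrable_iff_integrableOn_Ioc_of_le hab]
  refine IntegrableOn.of_bound (C := 1) (by simp) ?_ ?_
  · exact ((h.aemeasurable_load measurable_const).inv.mono_measure
        (Measure.restrict_mono hsub le_rfl)).aestronglyMeasurable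
  · refine Filter.Eventually.of_forall fun s => ?_
    have h2 := inv_load_one_mem (n := n) (A := A) (V := V) (S := S) s
    rw [Real.norm_eq_abs, abs_of_nonneg h2.1]
    exact h2.2

lemma S_sub {a b : ℝ} (ha : 0 ≤ a) (hab : a ≤ b) (hb : b ≤ τ) :
    S b - S a = ∫ s in a..b, (load n A V S (fun _ => 1) s)⁻¹ := by
  rw [h.S_eq b (ha.trans hab) hb, h.S_eq a ha (hab.trans hb)]
  exact intervalIntegral.integral_interval_sub_left
    (h.intervalIntegrable_inv le_rfl (ha.trans hab) hb)
    (h.intervalIntegrable_inv le_rfl ha (hab.trans hb))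

lemma S_mono {a b : ℝ} (ha : 0 ≤ a) (hab : a ≤ b) (hb : b ≤ τ) : S a ≤ S b := by
  have := h.S_sub ha hab hb
  have h2 : 0 ≤ ∫ s in a..b, (load n A V S (fun _ => 1) s)⁻¹ :=
    intervalIntegral.integral_nonneg hab fun s _ => (inv_load_one_mem s).1
  linarith

/-- Change of variables for the cumulative service process. -/
lemma comp_S_sub {G G' : ℝ → ℝ} (hG : ∀ x, HasDerivAt G (G' x) x) {C : ℝ}
    (hC : ∀ x, |G' x| ≤ C) (w : ℝ) {a b : ℝ} (ha : 0 ≤ a) (hab : a ≤ b) (hb : b ≤ τ) :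
    G (w - S b) - G (w - S a)
      = -∫ s in a..b, G' (w - S s) * (load n A V S (fun _ => 1) s)⁻¹ := by
  set c : ℝ → ℝ := fun s => (load n A V S (fun _ => 1) s)⁻¹ with hc
  have hInt := h.intervalIntegrable_inv ha hab hb
  set F : ℝ → ℝ := fun s => G (w - S a - ∫ x in a..s, c x) with hF
  have hS : ∀ s ∈ Set.Icc a b, S s = S a + ∫ x in a..s, c x := fun s hs => by
    have := h.S_sub ha hs.1 (hs.2.trans hb)
    linarith
  have hC0 : 0 ≤ C := (abs_nonneg _).trans (hC 0)
  have hLip : LipschitzWith C.toNNReal G := by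
    refine lipschitzWith_of_nnnorm_deriv_le (fun x => (hG x).differentiableAt) fun x => ?_
    rw [(hG x).deriv, ← NNReal.coe_le_coe, Real.coe_toNNReal _ hC0]
    simpa using hC x
  have hAC : AbsolutelyContinuousOnInterval F a b := by
    have hl : LipschitzOnWith 1 (fun s => w - S a - ∫ x in a..s, c x) (Set.uIcc a b) := by
      rw [Set.uIcc_of_le hab]
      refine LipschitzOnWith.of_dist_le_mul fun x hx y hy => ?_
      have hx' := hInt.mono_set (c := a) (d := x) (by
        rw [Set.uIcc_of_le hx.1, Set.uIcc_of_le hab]; exact Set.Icc_subset_Icc_right hx.2)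
      have hy' := hInt.mono_set (c := a) (d := y) (by
        rw [Set.uIcc_of_le hy.1, Set.uIcc_of_le hab]; exact Set.Icc_subset_Icc_right hy.2)
      have e : (w - S a - ∫ z in a..x, c z) - (w - S a - ∫ z in a..y, c z)
          = ∫ z in x..y, c z := by
        rw [← intervalIntegral.integral_interval_sub_left hy' hx']; ring
      rw [Real.dist_eq, e, ← Real.norm_eq_abs, Real.dist_eq, abs_sub_comm x y]
      refine intervalIntegral.norm_integral_le_of_norm_le_const fun z _ => ?_
      rw [Real.norm_eq_abs, abs_of_nonneg (inv_load_one_mem z).1]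
      exact (inv_load_one_mem z).2
    exact (hLip.lipschitzOnWith (s := Set.univ) |>.comp hl
      (Set.mapsTo_univ _ _)).absolutelyContinuousOnInterval
  have h1 := hAC.integral_deriv_eq_sub
  have h2 : ∫ s in a..b, deriv F s = ∫ s in a..b, -(G' (w - S s) * c s) := by
    refine intervalIntegral.integral_congr_ae ?_
    filter_upwards [hInt.ae_hasDerivAt_integral] with s hs hsm
    rw [Set.uIoc_of_le hab] at hsm
    have hs' := hs (by rw [Set.uIcc_of_le hab]; exact ⟨hsm.1.le, hsm.2⟩) a
      (by rw [Set.uIcc_of_le hab]; exact ⟨le_rfl, hab⟩)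
    have e : w - S s = w - S a - ∫ x in a..s, c x := by
      rw [hS s ⟨hsm.1.le, hsm.2⟩]; ring
    rw [e]
    have hd := ((hG (w - S a - ∫ x in a..s, c x)).comp s (hs'.const_sub (w - S a)))
    have hd' : deriv F s = _ := hd.deriv
    rw [hd']; ring
  rw [h2, intervalIntegral.integral_neg] at h1
  have e1 : F b = G (w - S b) := by
    rw [hS b ⟨hab, le_rfl⟩, hF]; simp only; congr 1; ring
  have e2 : F a = G (w - S a) := by simp [hF]
  rw [← e1, ← e2, ← h1]

end JobSys

end


lemma hasDerivAt_posExt {g g' : ℝ → ℝ} (hg : ∀ x, HasDerivAt g (g' x) x) (h0 : g 0 = 0)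
    (h0' : g' 0 = 0) (x : ℝ) :
    HasDerivAt (fun x => if 0 < x then g x else 0) (if 0 < x then g' x else 0) x := by
  rcases lt_trichotomy x 0 with hx | hx | hx
  · rw [if_neg (not_lt.2 hx.le)]
    refine (hasDerivAt_const x (0:ℝ)).congr_of_eventuallyEq ?_
    filter_upwards [Iio_mem_nhds hx] with y hy
    rw [if_neg (not_lt.2 (le_of_lt hy))]
  · subst hx
    rw [if_neg (lt_irrefl _), hasDerivAt_iff_isLittleO_nhds_zero]
    have := hasDerivAt_iff_isLittleO_nhds_zero.1 (hg 0)
    refine Asymptotics.IsBigO.trans_isLittleO (Asymptotics.IsBigO.of_bound 1 ?_) this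
    refine Filter.Eventually.of_forall fun y => ?_
    simp only [h0, h0', zero_add, lt_irrefl, if_false, smul_zero, sub_zero, one_mul]
    split_ifs
    · exact le_rfl
    · simp
  · rw [if_pos hx]
    refine (hg x).congr_of_eventuallyEq ?_
    filter_upwards [Ioi_mem_nhds hx] with y hy
    rw [if_pos (Set.mem_Ioi.1 hy)]

namespace JobSys

variable {n : ℕ} {A V : ℕ → ℝ} {S : ℝ → ℝ} {τ : ℝ} (h : JobSys n A V S τ)
include h

lemma intervalIntegrable_job {g' : ℝ → ℝ} (hm : Measurable g') {C : ℝ} (hC : ∀ x, |g' x| ≤ C)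
    (i : ℕ) {a b : ℝ} (ha : 0 ≤ a) (hab : a ≤ b) (hb : b ≤ τ) :
    IntervalIntegrable (fun s => (if A i ≤ s ∧ S s < V i + S (A i) then
      g' (V i + S (A i) - S s) else 0) * (load n A V S (fun _ => 1) s)⁻¹) volume a b := by
  have hsub : Set.Ioc a b ⊆ Set.Icc 0 τ := fun x hx => ⟨ha.trans hx.1.le, hx.2.trans hb⟩
  have hC0 : 0 ≤ C := (abs_nonneg _).trans (hC 0)
  rw [intervalIntegrable_iff_integrableOn_Ioc_of_le hab]
  refine IntegrableOn.of_bound (C := C) (by simp) ?_ ?_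
  · have hF : Measurable fun q : ℝ × ℝ =>
        if A i ≤ q.1 ∧ q.2 < V i + S (A i) then g' (V i + S (A i) - q.2) else 0 := by
      refine Measurable.ite ?_ ?_ measurable_const
      · exact (measurableSet_le measurable_const measurable_fst).inter
          (measurableSet_lt measurable_snd measurable_const)
      · exact hm.comp (measurable_const.sub measurable_snd)
    exact (((hF.comp_aemeasurable (aemeasurable_id.prodMk h.aemeasurable_S)).mul
      (h.aemeasurable_load measurable_const).inv).mono_measure
        (Measure.restrict_mono hsub le_rfl)).aestronglyMeasurable
  · refine Filter.Eventually.of_forall fun s => ?_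
    have h2 := inv_load_one_mem (n := n) (A := A) (V := V) (S := S) s
    rw [Real.norm_eq_abs, abs_mul, abs_of_nonneg h2.1]
    refine (mul_le_of_le_one_right (abs_nonneg _) h2.2).trans ?_
    split_ifs
    · exact hC _
    · simpa using hC0

lemma job_evolution {g g' : ℝ → ℝ} (hg : ∀ x, HasDerivAt g (g' x) x) (hm : Measurable g')
    {C : ℝ} (hC : ∀ x, |g' x| ≤ C) (h0 : g 0 = 0) (h0' : g' 0 = 0)
    (i : ℕ) {a b : ℝ} (ha : 0 ≤ a) (hab : a ≤ b) (hb : b ≤ τ) :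
    (∫ s in a..b, (if A i ≤ s ∧ S s < V i + S (A i) then
      g' (V i + S (A i) - S s) else 0) * (load n A V S (fun _ => 1) s)⁻¹) =
    (if a < A i ∧ A i ≤ b then g (V i) else 0)
      - (if A i ≤ b ∧ S b < V i + S (A i) then g (V i + S (A i) - S b) else 0)
      + (if A i ≤ a ∧ S a < V i + S (A i) then g (V i + S (A i) - S a) else 0) := by
  set w := V i + S (A i) with hw
  set G : ℝ → ℝ := fun x => if 0 < x then g x else 0 with hGd
  set G' : ℝ → ℝ := fun x => if 0 < x then g' x else 0 with hGd'
  have hG : ∀ x, HasDerivAt G (G' x) x := hasDerivAt_posExt hg h0 h0'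
  have hC0 : 0 ≤ C := (abs_nonneg _).trans (hC 0)
  have hG'C : ∀ x, |G' x| ≤ C := fun x => by
    simp only [hGd']; split_ifs
    · exact hC _
    · simpa using hC0
  have hterm : ∀ (f : ℝ → ℝ) (s : ℝ), (if A i ≤ s ∧ S s < w then f (w - S s) else 0)
      = if A i ≤ s then (if 0 < w - S s then f (w - S s) else 0) else 0 := fun f s => by
    rw [ite_and]; simp only [sub_pos]
  simp only [hterm]
  have key : ∀ a', 0 ≤ a' → a' ≤ b → A i ≤ a' →
      (∫ s in a'..b, (if A i ≤ s then (if 0 < w - S s then g' (w - S s) else 0) else 0)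
        * (load n A V S (fun _ => 1) s)⁻¹) = G (w - S a') - G (w - S b) := by
    intro a' ha' hab' hA
    have := h.comp_S_sub hG hG'C w ha' hab' hb
    rw [show G (w - S a') - G (w - S b) = -(G (w - S b) - G (w - S a')) by ring, this, neg_neg]
    refine intervalIntegral.integral_congr fun s hs => ?_
    rw [Set.uIcc_of_le hab'] at hs
    simp only [if_pos (hA.trans hs.1), hGd']
  have zero : ∀ b', a ≤ b' → b' ≤ A i →
      (∫ s in a..b', (if A i ≤ s then (if 0 < w - S s then g' (w - S s) else 0) else 0)
        * (load n A V S (fun _ => 1) s)⁻¹) = 0 := by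
    intro b' hab' hA
    refine intervalIntegral.integral_zero_ae ?_
    filter_upwards [compl_mem_ae_iff.2 (measure_singleton (μ := volume) b')] with s hs hsm
    rw [Set.uIoc_of_le hab'] at hsm
    have : s < A i := (lt_of_le_of_ne hsm.2 hs).trans_le hA
    rw [if_neg (not_le.2 this), zero_mul]
  rcases le_or_gt (A i) a with hA | hA
  · rw [key a ha hab hA, if_neg (fun h' => absurd h'.1 (not_lt.2 hA)), if_pos (hA.trans hab),
      if_pos hA]
    ring
  rcases le_or_gt (A i) b with hA' | hA'
  · have hsplit := intervalIntegral.integral_add_adjacent_intervals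
      (h.intervalIntegrable_job hm hC i ha hA.le (hA'.trans hb))
      (h.intervalIntegrable_job hm hC i (ha.trans hA.le) hA' hb)
    simp only [← hw, hterm] at hsplit
    rw [← hsplit, key _ (ha.trans hA.le) hA' le_rfl, zero _ hA.le le_rfl, if_pos ⟨hA, hA'⟩,
      if_pos hA', if_neg (not_le.2 hA)]
    have e : w - S (A i) = V i := by rw [hw]; ring
    have : G (V i) = g (V i) := by simp [hGd, h.V_pos i]
    rw [e, this]
    ring
  · rw [zero b hab hA'.le, if_neg (fun h' => absurd h'.2 (not_le.2 hA')),
      if_neg (not_le.2 hA'), if_neg (not_le.2 hA)]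
    ring

/-- The evolution equation of a processor-sharing system tested against `g`. -/
lemma evolution {g g' : ℝ → ℝ} (hg : ∀ x, HasDerivAt g (g' x) x) (hm : Measurable g')
    {C : ℝ} (hC : ∀ x, |g' x| ≤ C) (h0 : g 0 = 0) (h0' : g' 0 = 0)
    {a b : ℝ} (ha : 0 ≤ a) (hab : a ≤ b) (hb : b ≤ τ) :
    load n A V S g b = load n A V S g a
      - (∫ s in a..b, load n A V S g' s * (load n A V S (fun _ => 1) s)⁻¹)
      + inflow n A V g a b := by
  have e : ∀ s, load n A V S g' s * (load n A V S (fun _ => 1) s)⁻¹ =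
      ∑ i ∈ Finset.range n, (if A i ≤ s ∧ S s < V i + S (A i) then
      g' (V i + S (A i) - S s) else 0) * (load n A V S (fun _ => 1) s)⁻¹ := fun s => by
    rw [← Finset.sum_mul]; rfl
  simp only [e]
  rw [intervalIntegral.integral_finsetSum fun i _ => h.intervalIntegrable_job hm hC i ha hab hb,
    Finset.sum_congr rfl fun i _ => h.job_evolution hg hm hC h0 h0' i ha hab hb,
    Finset.sum_add_distrib, Finset.sum_sub_distrib]
  simp only [load, inflow]
  ring

lemma S_zero (hτ : 0 ≤ τ) : S 0 = 0 := by
  rw [h.S_eq 0 le_rfl hτ, intervalIntegral.integral_same]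

end JobSys


lemma card_le_two_of_adjacent (F : Finset ℕ) (h : ∀ i ∈ F, ∀ j ∈ F, i < j → j ≤ i + 1) :
    F.card ≤ 2 := by
  rcases F.eq_empty_or_nonempty with rfl | hne
  · simp
  · have hsub : F ⊆ {F.min' hne, F.min' hne + 1} := by
      intro j hj
      have h1 := F.min'_le j hj
      rcases h1.eq_or_lt with h2 | h2
      · simp [← h2]
      · have := h _ (F.min'_mem hne) j hj h2
        simp only [Finset.mem_insert, Finset.mem_singleton]
        right; omega
    exact (Finset.card_le_card hsub).trans Finset.card_le_two

namespace JobSys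

variable {n : ℕ} {A V : ℕ → ℝ} {S : ℝ → ℝ} {τ : ℝ}

/-- The number of jobs arrived by time `s` whose residual service time at time `u` lies
in `(0, κ)`. -/
noncomputable def old (n : ℕ) (A V : ℕ → ℝ) (S : ℝ → ℝ) (κ u s : ℝ) : ℝ :=
  ∑ i ∈ Finset.range n,
    if A i ≤ s ∧ S u < V i + S (A i) ∧ V i + S (A i) - S u < κ then 1 else 0

lemma load_lt_eq_old (κ u : ℝ) :
    load n A V S (fun y => if y < κ then 1 else 0) u = old n A V S κ u u := by
  refine Finset.sum_congr rfl fun i _ => ?_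
  rw [← ite_and]
  simp only [and_assoc]

lemma old_le_add {κ u s t : ℝ} :
    old n A V S κ u t ≤ old n A V S κ u s + inflow n A V (fun _ => 1) s t := by
  rw [old, old, inflow, ← Finset.sum_add_distrib]
  refine Finset.sum_le_sum fun i _ => ?_
  by_cases h1 : A i ≤ t ∧ S u < V i + S (A i) ∧ V i + S (A i) - S u < κ
  · rcases le_or_gt (A i) s with h2 | h2
    · rw [if_pos h1, if_pos ⟨h2, h1.2⟩]
      split_ifs <;> norm_num
    · rw [if_pos h1, if_pos (c := s < A i ∧ A i ≤ t) ⟨h2, h1.1⟩]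
      split_ifs <;> norm_num
  · rw [if_neg h1]
    split_ifs <;> norm_num

variable (h : JobSys n A V S τ)
include h

lemma old_le_load {κ u s : ℝ} (hs : 0 ≤ s) (hsu : s ≤ u) (hu : u ≤ τ) :
    old n A V S κ u s ≤ load n A V S (fun _ => 1) s := by
  have hS := h.S_mono hs hsu hu
  refine Finset.sum_le_sum fun i _ => ?_
  split_ifs with h1 h2 h2
  · exact le_rfl
  · exact absurd ⟨h1.1, hS.trans_lt h1.2.1⟩ h2
  · exact zero_le_one
  · exact le_rfl

lemma old_mul_le_load {κ u s : ℝ} (hs : 0 ≤ s) (hsu : s ≤ u) (hu : u ≤ τ) :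
    old n A V S κ u s * (S u - S s) ≤ load n A V S id s := by
  have hS := h.S_mono hs hsu hu
  rw [old, Finset.sum_mul]
  refine Finset.sum_le_sum fun i _ => ?_
  split_ifs with h1 h2 h2
  · simp only [id]; linarith [h1.2.1]
  · exact absurd ⟨h1.1, hS.trans_lt h1.2.1⟩ h2
  · simp only [id]; linarith [h2.2]
  · simp

lemma old_zero_le {κ u : ℝ} (hu0 : 0 ≤ u) (hu : u ≤ τ) :
    old n A V S κ u 0 ≤
      load n A V S (fun y => if S u ≤ y ∧ y ≤ S u + κ then 1 else 0) 0 := by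
  have hS0 := h.S_zero (hu0.trans hu)
  have hS := h.S_mono le_rfl hu0 hu
  refine Finset.sum_le_sum fun i _ => ?_
  by_cases h1 : A i ≤ 0 ∧ S u < V i + S (A i) ∧ V i + S (A i) - S u < κ
  · rw [if_pos h1, if_pos ⟨h1.1, hS.trans_lt h1.2.1⟩, hS0]
    exact (if_pos ⟨by linarith [h1.2.1], by linarith [h1.2.2]⟩).ge
  · rw [if_neg h1]
    beta_reduce
    split_ifs <;> norm_num

lemma old_le_add_windows {κ u s t : ℝ} (hκ : 0 < κ) (hs : 0 ≤ s) (htu : t ≤ u)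
    (hu : u ≤ τ) {N : ℕ} (hN : S u - S s + κ ≤ N * κ) :
    old n A V S κ u t ≤ old n A V S κ u s + ∑ k ∈ Finset.range (N + 1),
      if (k:ℝ) * κ < S u - S s + κ ∧ S u - S t < ((k:ℝ) + 1) * κ then
        inflow n A V (fun y => if (k:ℝ) * κ ≤ y ∧ y < ((k:ℝ) + 1) * κ then 1 else 0) s t
      else 0 := by
  have e : (∑ k ∈ Finset.range (N + 1),
      if (k:ℝ) * κ < S u - S s + κ ∧ S u - S t < ((k:ℝ) + 1) * κ then
        inflow n A V (fun y => if (k:ℝ) * κ ≤ y ∧ y < ((k:ℝ) + 1) * κ then 1 else 0) s t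
      else 0) = ∑ i ∈ Finset.range n, ∑ k ∈ Finset.range (N + 1),
      if (k:ℝ) * κ < S u - S s + κ ∧ S u - S t < ((k:ℝ) + 1) * κ then
        (if s < A i ∧ A i ≤ t then
          (if (k:ℝ) * κ ≤ V i ∧ V i < ((k:ℝ) + 1) * κ then (1:ℝ) else 0) else 0)
      else 0 := by
    rw [Finset.sum_comm]
    refine Finset.sum_congr rfl fun k _ => ?_
    split_ifs
    · rfl
    · simp
  rw [e, old, old, ← Finset.sum_add_distrib]
  refine Finset.sum_le_sum fun i _ => ?_
  have hnn : ∀ k ∈ Finset.range (N + 1), (0:ℝ) ≤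
      if (k:ℝ) * κ < S u - S s + κ ∧ S u - S t < ((k:ℝ) + 1) * κ then
        (if s < A i ∧ A i ≤ t then
          (if (k:ℝ) * κ ≤ V i ∧ V i < ((k:ℝ) + 1) * κ then (1:ℝ) else 0) else 0)
      else 0 := fun k _ => by split_ifs <;> norm_num
  by_cases h1 : A i ≤ t ∧ S u < V i + S (A i) ∧ V i + S (A i) - S u < κ
  · rcases le_or_gt (A i) s with h2 | h2
    · rw [if_pos h1, if_pos ⟨h2, h1.2⟩]
      linarith [Finset.sum_nonneg hnn]
    · rw [if_pos h1]
      have hA1 : S s ≤ S (A i) := h.S_mono hs h2.le (h1.1.trans (htu.trans hu))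
      have hA2 : S (A i) ≤ S t := h.S_mono (h.A_nonneg i) h1.1 (htu.trans hu)
      have hV := h.V_pos i
      have hk1 : (⌊V i / κ⌋₊ : ℝ) * κ ≤ V i := by
        rw [← le_div_iff₀ hκ]; exact Nat.floor_le (by positivity)
      have hk2 : V i < ((⌊V i / κ⌋₊ : ℝ) + 1) * κ := by
        rw [← div_lt_iff₀ hκ]; exact Nat.lt_floor_add_one _
      have hkN : ⌊V i / κ⌋₊ ∈ Finset.range (N + 1) := by
        rw [Finset.mem_range, Nat.lt_succ_iff]
        have : (⌊V i / κ⌋₊ : ℝ) * κ ≤ N * κ := by linarith [h1.2.2]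
        exact_mod_cast le_of_mul_le_mul_right this hκ
      have hle := Finset.single_le_sum hnn hkN
      rw [if_pos ⟨by linarith [h1.2.2], by linarith [h1.2.1]⟩, if_pos ⟨h2, h1.1⟩,
        if_pos ⟨hk1, hk2⟩] at hle
      have : (0:ℝ) ≤ if A i ≤ s ∧ S u < V i + S (A i) ∧ V i + S (A i) - S u < κ
        then 1 else 0 := by split_ifs <;> norm_num
      linarith
  · rw [if_neg h1]
    have : (0:ℝ) ≤ if A i ≤ s ∧ S u < V i + S (A i) ∧ V i + S (A i) - S u < κ
        then 1 else 0 := by split_ifs <;> norm_num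
    linarith [Finset.sum_nonneg hnn]

/-- If the total load stays positive and bounded on `[a, b]`, the service per job grows at
least linearly there. -/
lemma le_S_sub {a b M' : ℝ} (ha : 0 ≤ a) (hab : a ≤ b) (hb : b ≤ τ)
    (hM : ∀ s ∈ Set.Icc a b, load n A V S (fun _ => 1) s ≤ M')
    (hpos : ∀ s ∈ Set.Icc a b, 0 < load n A V S (fun _ => 1) s) :
    (b - a) / M' ≤ S b - S a := by
  rw [h.S_sub ha hab hb]
  have : ∫ _ in a..b, M'⁻¹ = (b - a) / M' := by
    rw [intervalIntegral.integral_const, smul_eq_mul, div_eq_mul_inv]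
  rw [← this]
  refine intervalIntegral.integral_mono_on hab (by simp)
    (h.intervalIntegrable_inv ha hab hb) fun s hs => ?_
  exact inv_anti₀ (hpos s hs) (hM s hs)

/-- Few jobs have a small residual service time. -/
lemma load_near_zero_le {κ δ D B B0 X M' u : ℝ} {N : ℕ} {c : ℕ → ℝ}
    (hκ : 0 < κ) (hδ : 0 < δ) (hu0 : 0 ≤ u) (hu : u ≤ τ)
    (hM : ∀ a ∈ Set.Icc 0 u, load n A V S (fun _ => 1) a ≤ M') (hMκ : 2 * κ ≤ δ / M')
    (hX : ∀ a ∈ Set.Icc 0 u, load n A V S id a ≤ X) (hX0 : 0 ≤ X) (hD : 0 < D)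
    (hB : ∀ a ∈ Set.Icc 0 u, inflow n A V (fun _ => 1) a (a + δ) ≤ B)
    (h0 : ∀ x, 0 ≤ x → load n A V S (fun y => if x ≤ y ∧ y ≤ x + κ then 1 else 0) 0 ≤ B0)
    (hN : D + κ ≤ N * κ) (hc0 : ∀ k, 0 ≤ c k)
    (hc : ∀ a ∈ Set.Icc 0 u, ∀ k ≤ N, inflow n A V
      (fun y => if (k:ℝ) * κ ≤ y ∧ y < ((k:ℝ) + 1) * κ then 1 else 0) a (a + δ) ≤ c k) :
    load n A V S (fun y => if y < κ then 1 else 0) u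
      ≤ max B0 (X / D) + B + 2 * ∑ k ∈ Finset.range (N + 1), c k := by
  rw [load_lt_eq_old]
  set U : ℕ → ℝ := fun i => u - i * δ with hU
  have hUs : ∀ i, U i = U (i + 1) + δ := fun i => by simp only [hU]; push_cast; ring
  have hUanti : ∀ i j, i ≤ j → U j ≤ U i := fun i j hij => by
    have : (i:ℝ) ≤ j := by exact_mod_cast hij
    simp only [hU]
    nlinarith
  have hUu : ∀ i, U i ≤ u := fun i => by
    simp only [hU]
    have : 0 ≤ (i:ℝ) * δ := by positivity
    linarith
  have hU0 : U 0 = u := by simp [hU]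
  let P : ℕ → Prop := fun K => 0 ≤ U K ∧ (∀ i < K, 2 * κ ≤ S (U i) - S (U (i + 1))) ∧
    S u - S (U K) < D
  have hP0 : P 0 := ⟨by rw [hU0]; exact hu0, fun i hi => absurd hi (by omega),
    by rw [hU0]; simpa using hD⟩
  have hex : ∃ K, ¬ P K := by
    obtain ⟨K, hK⟩ := exists_nat_gt (u / δ)
    refine ⟨K, fun hP => ?_⟩
    have := hP.1
    rw [div_lt_iff₀ hδ] at hK
    simp only [hU] at this
    linarith
  classical
  obtain ⟨K, hPK, hnP⟩ : ∃ K, P K ∧ ¬ P (K + 1) := by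
    have h1 := Nat.find_spec hex
    have h2 : Nat.find hex ≠ 0 := fun h' => by rw [h'] at h1; exact h1 hP0
    obtain ⟨K, hK⟩ := Nat.exists_eq_succ_of_ne_zero h2
    refine ⟨K, ?_, by rw [hK] at h1; exact h1⟩
    by_contra hcon
    exact Nat.find_min hex (by omega) hcon
  obtain ⟨hK1, hK2, hK3⟩ := hPK
  have hpos : ∀ i ≤ K, 0 ≤ U i := fun i hi => hK1.trans (hUanti _ _ hi)
  -- the oldest jobs
  have hfirst : old n A V S κ u (U K) ≤ max B0 (X / D) + B := by
    rcases lt_or_ge (U (K + 1)) 0 with hneg | hnn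
    · have e1 := old_le_add (n := n) (A := A) (V := V) (S := S) (κ := κ) (u := u) (s := 0) (t := U K)
      have e2 := (h.old_zero_le (κ := κ) hu0 hu).trans
        (h0 (S u) (by have := h.S_mono le_rfl hu0 hu; rwa [h.S_zero (hu0.trans hu)] at this))
      have e3 : inflow n A V (fun _ => 1) 0 (U K) ≤ inflow n A V (fun _ => 1) 0 (0 + δ) :=
        inflow_one_mono (by have := hUs K; linarith)
      have e4 := hB 0 ⟨le_rfl, hu0⟩
      linarith [le_max_left B0 (X / D)]
    · have hmem : U (K + 1) ∈ Set.Icc 0 u := ⟨hnn, hUu _⟩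
      have hle : U (K + 1) ≤ U K := hUanti _ _ (by omega)
      have e4 := hB _ hmem
      rw [← hUs K] at e4
      have hB0 : 0 ≤ max B0 (X / D) := le_max_of_le_right (by positivity)
      by_cases hz : ∃ s ∈ Set.Icc (U (K + 1)) (U K), load n A V S (fun _ => 1) s ≤ 0
      · obtain ⟨s, hs, hs0⟩ := hz
        have e1 := old_le_add (n := n) (A := A) (V := V) (S := S) (κ := κ) (u := u) (s := s) (t := U K)
        have e2 := h.old_le_load (κ := κ) (hnn.trans hs.1) (hs.2.trans (hUu K)) hu
        have e3 : inflow n A V (fun _ => 1) s (U K) ≤ inflow n A V (fun _ => 1) (U (K+1)) (U K) :=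
          inflow_one_mono_left hs.1
        linarith
      · push Not at hz
        have hinc := h.le_S_sub hnn hle ((hUu K).trans hu)
          (fun s hs => hM s ⟨hnn.trans hs.1, hs.2.trans (hUu K)⟩) hz
        have hd : U K - U (K + 1) = δ := by have := hUs K; linarith
        rw [hd] at hinc
        have hbig : D ≤ S u - S (U (K + 1)) := by
          by_contra hcon
          refine hnP ⟨hnn, fun i hi => ?_, not_le.1 hcon⟩
          rcases (Nat.lt_succ_iff.1 hi).eq_or_lt with h1 | h1
          · rw [h1]; linarith
          · exact hK2 i h1
        have e1 := old_le_add (n := n) (A := A) (V := V) (S := S) (κ := κ) (u := u) (s := U (K + 1)) (t := U K)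
        have e2 := h.old_mul_le_load (κ := κ) hnn (hUu (K + 1)) hu
        have e3 := hX _ hmem
        have hold0 : 0 ≤ old n A V S κ u (U (K + 1)) :=
          Finset.sum_nonneg fun i _ => by split_ifs <;> norm_num
        have e5 : old n A V S κ u (U (K + 1)) ≤ X / D := by
          rw [le_div_iff₀ hD]
          exact (mul_le_mul_of_nonneg_left hbig hold0).trans (e2.trans e3)
        linarith [le_max_right B0 (X / D)]
  -- the arrivals in each time step
  set W : ℕ → ℝ := fun i => ∑ k ∈ Finset.range (N + 1),
    if (k:ℝ) * κ < S u - S (U (i + 1)) + κ ∧ S u - S (U i) < ((k:ℝ) + 1) * κ then c k else 0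
    with hW
  have hstep : ∀ i < K, old n A V S κ u (U i) ≤ old n A V S κ u (U (i + 1)) + W i := by
    intro i hi
    have hnn := hpos (i + 1) hi
    have hS1 : S (U K) ≤ S (U (i + 1)) :=
      h.S_mono hK1 (hUanti _ _ hi) ((hUu _).trans hu)
    refine (h.old_le_add_windows (N := N) hκ hnn (hUu i) hu
      (by linarith)).trans ?_
    refine add_le_add_right (Finset.sum_le_sum fun k hk => ?_) _
    split_ifs
    · have := hc _ ⟨hnn, hUu _⟩ k (by simpa [Nat.lt_succ_iff] using hk)
      rwa [← hUs i] at this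
    · exact le_rfl
  have hsum : ∀ j ≤ K, old n A V S κ u u ≤ old n A V S κ u (U j) + ∑ i ∈ Finset.range j, W i := by
    intro j
    induction j with
    | zero => intro _; simp [hU0]
    | succ j ih =>
      intro hj
      rw [Finset.sum_range_succ]
      linarith [ih (by omega), hstep j (by omega)]
  have hWsum : ∑ i ∈ Finset.range K, W i ≤ 2 * ∑ k ∈ Finset.range (N + 1), c k := by
    simp only [hW]
    rw [Finset.sum_comm, Finset.mul_sum]
    refine Finset.sum_le_sum fun k _ => ?_
    rw [← Finset.sum_filter, Finset.sum_const, nsmul_eq_mul]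
    refine mul_le_mul_of_nonneg_right ?_ (hc0 k)
    have := card_le_two_of_adjacent ((Finset.range K).filter fun i =>
      (k:ℝ) * κ < S u - S (U (i + 1)) + κ ∧ S u - S (U i) < ((k:ℝ) + 1) * κ) ?_
    · exact_mod_cast this
    · intro i hi j hj hij
      simp only [Finset.mem_filter, Finset.mem_range] at hi hj
      by_contra hcon
      have e1 : S (U j) ≤ S (U (i + 1 + 1)) :=
        h.S_mono (hpos j hj.1.le) (hUanti _ _ (by omega)) ((hUu _).trans hu)
      have e2 := hK2 (i + 1) (by omega)
      linarith [hi.2.1, hj.2.2]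
  linarith [hsum K le_rfl]

end JobSys


lemma mass_eq_pair (ζ : Measure ℝ) : mass ζ = pair (fun _ => 1) ζ := by
  simp [mass, pair, Measure.real]

instance (x : ℝ) : IsFiniteMeasure (dplus x) := by
  unfold dplus; split_ifs <;> infer_instance

lemma integrable_dplus (f : ℝ → ℝ) (x : ℝ) : Integrable f (dplus x) := by
  unfold dplus
  split_ifs
  · exact integrable_dirac (by simp)
  · exact integrable_zero_measure

lemma dplus_Iic (x : ℝ) : dplus x (Set.Iic 0) = 0 := by
  unfold dplus
  split_ifs with h
  · rw [Measure.dirac_apply' _ measurableSet_Iic]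
    simp [h]
  · simp

lemma pair_dplus_pos (f : ℝ → ℝ) (x : ℝ) :
    pair f (dplus (pos x)) = if 0 < x then f x else 0 := by
  unfold pair dplus pos
  by_cases h : 0 < x
  · have h' : 0 < max x 0 := lt_max_of_lt_left h
    rw [if_pos h, if_pos h', integral_dirac, max_eq_left h.le]
  · have h' : ¬ 0 < max x 0 := by simpa using h
    rw [if_neg h, if_neg h', integral_zero_measure]

lemma pair_fmu (f : ℝ → ℝ) (μ : ℝ → Measure ℝ) {r : ℝ} (hr : 0 < r) (t : ℝ) :
    pair f (fmu μ r t) = (1 / r) * pair f (μ (r * t)) := by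
  unfold pair fmu
  rw [integral_smul_measure, ENNReal.toReal_ofReal (by positivity), smul_eq_mul]

section

variable {U v : ℕ → ℝ} {Z0 : ℕ} {vt : ℕ → ℝ} {μ : ℝ → Measure ℝ} {S : ℝ → ℝ}

lemma le_Ecount_iff (h : QueueHyps U v Z0 vt) {t : ℝ} (ht : 0 ≤ t) (i : ℕ) :
    i ≤ Ecount U t ↔ U i ≤ t := by
  obtain ⟨h0, hm, -, htop, -⟩ := h
  obtain ⟨k, hk⟩ := (htop.eventually_gt_atTop t).exists
  have hbdd : BddAbove {i : ℕ | U i ≤ t} := ⟨k, fun j hj => by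
    by_contra hcon
    exact absurd (hm (not_le.1 hcon).le) (not_le.2 (lt_of_le_of_lt hj hk))⟩
  have hmem : Ecount U t ∈ {i : ℕ | U i ≤ t} :=
    Nat.sSup_mem ⟨0, by simpa [h0] using ht⟩ hbdd
  exact ⟨fun hi => (hm hi).trans hmem, fun hi => le_csSup hbdd hi⟩

lemma Ecount_mono (h : QueueHyps U v Z0 vt) {s t : ℝ} (hs : 0 ≤ s) (hst : s ≤ t) :
    Ecount U s ≤ Ecount U t :=
  (le_Ecount_iff h (hs.trans hst) _).2 (((le_Ecount_iff h hs _).1 le_rfl).trans hst)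

/-- Arrival times of the jobs, the `Z0` initial jobs first. -/
def jobArrival (U : ℕ → ℝ) (Z0 : ℕ) (i : ℕ) : ℝ := if i < Z0 then 0 else U (i - Z0 + 1)

/-- Service times of the jobs, the `Z0` initial jobs first. -/
def jobService (v : ℕ → ℝ) (Z0 : ℕ) (vt : ℕ → ℝ) (i : ℕ) : ℝ :=
  if i < Z0 then vt (i + 1) else v (i - Z0 + 1)

lemma StateEqns.integrable (h : StateEqns U v Z0 vt μ S) {t : ℝ} (ht : 0 ≤ t) (f : ℝ → ℝ) :
    Integrable f (μ t) := by
  rw [(h t ht).2]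
  exact ((integrable_finsetSum_measure).2 fun i _ => integrable_dplus _ _).add_measure
    ((integrable_finsetSum_measure).2 fun i _ => integrable_dplus _ _)

lemma StateEqns.isFiniteMeasure (h : StateEqns U v Z0 vt μ S) {t : ℝ} (ht : 0 ≤ t) :
    IsFiniteMeasure (μ t) := by
  rw [(h t ht).2]
  infer_instance

lemma StateEqns.apply_Iic (h : StateEqns U v Z0 vt μ S) {t : ℝ} (ht : 0 ≤ t) :
    μ t (Set.Iic 0) = 0 := by
  rw [(h t ht).2]
  simp [dplus_Iic]

lemma StateEqns.pair_eq_load (h : StateEqns U v Z0 vt μ S) (hq : QueueHyps U v Z0 vt)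
    {t τ : ℝ} (ht : 0 ≤ t) (htτ : t ≤ τ) (f : ℝ → ℝ) :
    pair f (μ t) =
      load (Z0 + Ecount U τ) (jobArrival U Z0) (jobService v Z0 vt) S f t := by
  have hS0 : S 0 = 0 := by rw [(h 0 le_rfl).1, intervalIntegral.integral_same]
  have hInt : ∀ (s : Finset ℕ) (x : ℕ → ℝ),
      pair f (∑ i ∈ s, dplus (pos (x i))) = ∑ i ∈ s, if 0 < x i then f (x i) else 0 := by
    intro s x
    unfold pair
    rw [integral_finsetSum_measure fun i _ => integrable_dplus _ _]
    exact Finset.sum_congr rfl fun i _ => pair_dplus_pos f _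
  have hadd : pair f (μ t) =
      pair f (∑ j ∈ Finset.range Z0, dplus (pos (vt (j+1) - S t)))
        + pair f (∑ i ∈ Finset.range (Ecount U t), dplus (pos (v (i+1) - S t + S (U (i+1))))) := by
    rw [(h t ht).2]
    exact integral_add_measure
      ((integrable_finsetSum_measure).2 fun i _ => integrable_dplus _ _)
      ((integrable_finsetSum_measure).2 fun i _ => integrable_dplus _ _)
  rw [hadd, hInt, hInt, load, Finset.sum_range_add]
  congr 1
  · refine Finset.sum_congr rfl fun i hi => ?_
    have hi' := Finset.mem_range.1 hi
    simp only [jobArrival, jobService, if_pos hi', hS0, add_zero, ht, true_and, sub_pos]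
  · have hfilter : Finset.range (Ecount U t) =
        (Finset.range (Ecount U τ)).filter fun i => U (i + 1) ≤ t := by
      ext i
      simp only [Finset.mem_range, Finset.mem_filter]
      rw [← le_Ecount_iff hq ht]
      have := Ecount_mono hq ht htτ
      omega
    rw [hfilter, Finset.sum_filter]
    refine Finset.sum_congr rfl fun i hi => ?_
    have e1 : jobArrival U Z0 (Z0 + i) = U (i + 1) := by simp [jobArrival]
    have e2 : jobService v Z0 vt (Z0 + i) = v (i + 1) := by simp [jobService]
    rw [e1, e2, ite_and]
    have e3 : v (i + 1) - S t + S (U (i + 1)) = v (i + 1) + S (U (i + 1)) - S t := by ring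
    rw [e3]
    simp only [sub_pos]

lemma StateEqns.jobSys (h : StateEqns U v Z0 vt μ S) (hq : QueueHyps U v Z0 vt) (τ : ℝ) :
    JobSys (Z0 + Ecount U τ) (jobArrival U Z0) (jobService v Z0 vt) S τ where
  A_nonneg i := by
    unfold jobArrival
    split_ifs
    · exact le_rfl
    · rw [← hq.1]; exact hq.2.1 (Nat.zero_le _)
  V_pos i := by
    unfold jobService
    split_ifs
    · exact hq.2.2.2.2.2 _ (by omega)
    · exact hq.2.2.2.2.1 _ (by omega)
  S_eq t ht htτ := by
    rw [(h t ht).1]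
    refine intervalIntegral.integral_congr fun s hs => ?_
    rw [Set.uIcc_of_le ht] at hs
    rw [mass_eq_pair, h.pair_eq_load hq hs.1 (hs.2.trans htτ)]

lemma sum_Ioc_Ecount (hq : QueueHyps U v Z0 vt) {a b τ : ℝ} (ha : 0 ≤ a) (hab : a ≤ b)
    (hb : b ≤ τ) (f : ℝ → ℝ) :
    ∑ i ∈ Finset.Ioc (Ecount U a) (Ecount U b), f (v i) =
      inflow (Z0 + Ecount U τ) (jobArrival U Z0) (jobService v Z0 vt) f a b := by
  rw [inflow, Finset.sum_range_add, Finset.sum_eq_zero (s := Finset.range Z0), zero_add]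
  · have e1 : ∀ i, jobArrival U Z0 (Z0 + i) = U (i + 1) := by simp [jobArrival]
    have e2 : ∀ i, jobService v Z0 vt (Z0 + i) = v (i + 1) := by simp [jobService]
    simp only [e1, e2]
    rw [← Finset.sum_filter]
    refine Finset.sum_nbij' (fun i => i - 1) (fun i => i + 1) ?_ ?_ ?_ ?_ ?_
    · intro i hi
      simp only [Finset.mem_Ioc, Finset.mem_filter, Finset.mem_range] at hi ⊢
      have e3 : i - 1 + 1 = i := by omega
      have e4 := Ecount_mono hq (ha.trans hab) hb
      rw [e3]
      exact ⟨by omega, not_le.1 fun h => by have := (le_Ecount_iff hq ha i).2 h; omega,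
        (le_Ecount_iff hq (ha.trans hab) i).1 hi.2⟩
    · intro i hi
      simp only [Finset.mem_Ioc, Finset.mem_filter, Finset.mem_range] at hi ⊢
      exact ⟨not_le.1 fun h => absurd ((le_Ecount_iff hq ha _).1 h) (not_le.2 hi.2.1),
        (le_Ecount_iff hq (ha.trans hab) _).2 hi.2.2⟩
    · intro i hi
      simp only [Finset.mem_Ioc] at hi
      omega
    · intro i hi
      simp
    · intro i hi
      simp only [Finset.mem_Ioc] at hi
      rw [show i - 1 + 1 = i by omega]
  · intro i hi
    have hi' := Finset.mem_range.1 hi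
    simp only [jobArrival, if_pos hi']
    rw [if_neg fun h' => absurd h'.1 (not_lt.2 ha)]

lemma Ecount_sub (hq : QueueHyps U v Z0 vt) {a b τ : ℝ} (ha : 0 ≤ a) (hab : a ≤ b)
    (hb : b ≤ τ) : (Ecount U b : ℝ) - Ecount U a =
      inflow (Z0 + Ecount U τ) (jobArrival U Z0) (jobService v Z0 vt) (fun _ => 1) a b := by
  rw [← sum_Ioc_Ecount hq ha hab hb, Finset.sum_const, Nat.card_Ioc, nsmul_eq_mul, mul_one,
    Nat.cast_sub (Ecount_mono hq ha hab)]

end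

/-- The unscaled form of the good-path properties at a given level. -/
structure GoodSys (S : Setting) (L r : ℝ) (n' : ℕ) (N : ℕ) (A V : ℕ → ℝ) (Sf : ℝ → ℝ) : Prop
    extends JobSys N A V Sf (r * (⌊r * S.T⌋₊ + L + S.lseq n')) where
  inflow_one_le : ∀ m ≤ ⌊r * S.T⌋₊, ∀ t ∈ Set.Icc (0:ℝ) L,
    inflow N A V (fun _ => 1) (r * (m + t)) (r * (m + t + S.lseq n')) ≤ r * (S.εseq n' / 16)
  load_one_le : ∀ m ≤ ⌊r * S.T⌋₊, ∀ t ∈ Set.Icc (0:ℝ) L,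
    load N A V Sf (fun _ => 1) (r * (m + t)) ≤ r * S.M
  load_id_le : ∀ m ≤ ⌊r * S.T⌋₊, ∀ t ∈ Set.Icc (0:ℝ) L,
    load N A V Sf id (r * (m + t)) ≤ r * S.M
  load_pow_le : ∀ m ≤ ⌊r * S.T⌋₊, ∀ t ∈ Set.Icc (0:ℝ) L,
    load N A V Sf (fun x => x ^ ((1:ℝ) + S.p)) (r * (m + t)) ≤ r * S.M
  load_zero_le : ∀ x, 0 ≤ x →
    load N A V Sf (fun y => if x ≤ y ∧ y ≤ x + S.κseq n' then 1 else 0) 0 ≤ r * (S.εseq n' / 4)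
  load_id_sub_le : ∀ m ≤ ⌊r * S.T⌋₊, ∀ t ∈ Set.Icc (0:ℝ) L,
    |load N A V Sf id (r * (m + t)) - load N A V Sf id (r * m)| ≤ r * (S.γseq n' / 4)
  inflow_window_le : ∀ m ≤ ⌊r * S.T⌋₊, ∀ t ∈ Set.Icc (0:ℝ) L,
    ∀ k : ℕ, k ≤ ⌈64*S.M^2/(S.κseq n'*S.εseq n'^2)⌉₊ + 1 →
    inflow N A V
      (fun y => if (k:ℝ) * S.κseq n' ≤ y ∧ y < ((k:ℝ) + 1) * S.κseq n' then 1 else 0)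
      (r * (m + t)) (r * (m + t + S.lseq n')) ≤
    r * ((S.εseq n' / 8) *
      (S.ν (Set.Ico (((k:ℝ)-1/2)*S.κseq n') (((k:ℝ)+3/2)*S.κseq n'))).toReal)
  inflow_test : ∀ k ≤ n', ∀ j : ℕ, 1 ≤ j → j ≤ ⌊L / S.lseq n'⌋₊ → ∀ m ≤ ⌊r * S.T⌋₊,
    |(1/r) * inflow N A V (S.V k) (r * m) (r * (m + j * S.lseq n'))
      - S.α * j * S.lseq n' * pair (S.V k) S.ν| ≤ S.εseq n'

lemma Setting.memBLr.exists_goodSys {S : Setting} {L r : ℝ} {ζ : ℝ → Measure ℝ}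
    (hζ : S.memBLr L r ζ) (hr : 0 < r) (hL : 1 < L) {n' : ℕ} (hn : n' ≤ S.nIdx r) :
    ∃ (N : ℕ) (A V : ℕ → ℝ) (Sf : ℝ → ℝ) (m : ℕ), GoodSys S L r n' N A V Sf ∧
      m ≤ ⌊r * S.T⌋₊ ∧ ∀ t ∈ Set.Icc (0:ℝ) L, IsFiniteMeasure (ζ t) ∧ ζ t (Set.Iic 0) = 0 ∧
        ∀ f : ℝ → ℝ, Integrable f (ζ t) ∧
          pair f (ζ t) = (1 / r) * load N A V Sf f (r * (m + t)) := by
  obtain ⟨U, v, Z0, vt, μ, Sf, m, hq, hst, hm, hζμ, hgood⟩ := hζ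
  obtain ⟨hgp, htest, -⟩ := hgood n' hn
  have hl := S.hl n'
  set l := S.lseq n' with hl_def
  set τ := r * (⌊r * S.T⌋₊ + L + l) with hτ
  have hrng : ∀ m' : ℕ, m' ≤ ⌊r * S.T⌋₊ → ∀ t ∈ Set.Icc (0:ℝ) L,
      0 ≤ r * (m' + t) ∧ r * (m' + t) ≤ r * (m' + t + l) ∧ r * (m' + t + l) ≤ τ := by
    intro m' hm' t ht
    have h1 : (m':ℝ) ≤ ⌊r * S.T⌋₊ := by exact_mod_cast hm'
    refine ⟨mul_nonneg hr.le (add_nonneg (Nat.cast_nonneg _) ht.1), ?_, ?_⟩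
    · exact mul_le_mul_of_nonneg_left (by linarith) hr.le
    · exact mul_le_mul_of_nonneg_left (by linarith [ht.2]) hr.le
  have hload : ∀ m' : ℕ, m' ≤ ⌊r * S.T⌋₊ → ∀ t ∈ Set.Icc (0:ℝ) L, ∀ f : ℝ → ℝ,
      pair f (fmu μ r (m' + t)) = (1 / r) *
        load (Z0 + Ecount U τ) (jobArrival U Z0) (jobService v Z0 vt) Sf f (r * (m' + t)) := by
    intro m' hm' t ht f
    obtain ⟨h1, h2, h3⟩ := hrng m' hm' t ht
    rw [pair_fmu f μ hr, hst.pair_eq_load hq h1 (h2.trans h3)]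
  have hr' : ∀ x y : ℝ, (1 / r) * x ≤ y ↔ x ≤ r * y := fun x y => by
    rw [one_div, inv_mul_le_iff₀ hr]
  have hL0 : (0:ℝ) ∈ Set.Icc (0:ℝ) L := ⟨le_rfl, by linarith⟩
  refine ⟨Z0 + Ecount U τ, jobArrival U Z0, jobService v Z0 vt, Sf, m,
    { toJobSys := hst.jobSys hq τ
      inflow_one_le := ?_
      load_one_le := ?_
      load_id_le := ?_
      load_pow_le := ?_
      load_zero_le := ?_
      load_id_sub_le := ?_
      inflow_window_le := ?_
      inflow_test := ?_ }, hm, ?_⟩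
  · intro m' hm' t ht
    obtain ⟨h1, h2, h3⟩ := hrng m' hm' t ht
    have := (hgp m' hm').1 t ht
    rw [fE, fE, ← sub_div, Ecount_sub hq h1 h2 h3, div_le_iff₀ hr] at this
    exact this.trans_eq (mul_comm _ _)
  · intro m' hm' t ht
    have := (le_max_left _ _).trans ((le_max_left _ _).trans ((hgp m' hm').2.1 t ht))
    rwa [mass_eq_pair, hload m' hm' t ht, hr'] at this
  · intro m' hm' t ht
    have := (le_max_right _ _).trans ((le_max_left _ _).trans ((hgp m' hm').2.1 t ht))
    rwa [hload m' hm' t ht, hr'] at this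
  · intro m' hm' t ht
    have := (le_max_right _ _).trans ((hgp m' hm').2.1 t ht)
    rwa [hload m' hm' t ht, hr'] at this
  · intro x hx
    have h1 := (hgp 0 (Nat.zero_le _)).2.2.1 x hx
    have h2 : (fmu μ r 0 (Set.Icc x (x + S.κseq n'))).toReal =
        pair (fun y => if x ≤ y ∧ y ≤ x + S.κseq n' then 1 else 0) (fmu μ r 0) := by
      have : (fun y : ℝ => if x ≤ y ∧ y ≤ x + S.κseq n' then (1:ℝ) else 0) =
          (Set.Icc x (x + S.κseq n')).indicator 1 := by
        funext y; simp [Set.indicator, Set.mem_Icc]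
      rw [pair, this, integral_indicator_one measurableSet_Icc, Measure.real]
    have h3 := hload 0 (Nat.zero_le _) 0 hL0
      (fun y => if x ≤ y ∧ y ≤ x + S.κseq n' then 1 else 0)
    simp only [Nat.cast_zero, add_zero, mul_zero] at h3
    rwa [h2, h3, hr'] at h1
  · intro m' hm' t ht
    have h1 := (hgp m' hm').2.2.2.1 t ht
    have h2 := hload m' hm' 0 hL0 id
    simp only [add_zero] at h2
    rwa [hload m' hm' t ht, h2, ← mul_sub, abs_mul, abs_of_pos (by positivity : 0 < 1 / r),
      hr'] at h1
  · intro m' hm' t ht k hk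
    obtain ⟨h1, h2, h3⟩ := hrng m' hm' t ht
    have := (hgp m' hm').2.2.2.2 t ht k hk
    rw [hr', sum_Ioc_Ecount hq h1 h2 h3
      (fun y => if (k:ℝ) * S.κseq n' ≤ y ∧ y < ((k:ℝ) + 1) * S.κseq n' then (1:ℝ) else 0)] at this
    exact this
  · intro k hk j hj1 hj2 m' hm'
    have h1 : (m':ℝ) ≤ ⌊r * S.T⌋₊ := by exact_mod_cast hm'
    have h2 : (j:ℝ) * l ≤ L := by
      rw [← le_div_iff₀ hl]
      exact (Nat.le_floor_iff (by positivity)).1 hj2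
    have h3 : 0 ≤ (j:ℝ) * l := by positivity
    have := htest k hk j hj1 hj2 m' hm'
    rw [arrSum, sum_Ioc_Ecount (τ := τ) hq (by positivity) 
      (mul_le_mul_of_nonneg_left (by linarith) hr.le)
      (mul_le_mul_of_nonneg_left (by linarith) hr.le)] at this
    exact this
  · intro t ht
    obtain ⟨h1, -, -⟩ := hrng m hm t ht
    rw [hζμ t ht]
    have hfin := hst.isFiniteMeasure h1
    refine ⟨?_, ?_, fun f => ⟨?_, hload m hm t ht f⟩⟩
    · unfold fmu
      exact Measure.smul_finite _ ENNReal.ofReal_ne_top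
    · simp [fmu, hst.apply_Iic h1]
    · exact (hst.integrable h1 f).smul_measure ENNReal.ofReal_ne_top


lemma sum_measureReal_Ico_add_two_le (ν : Measure ℝ) [IsProbabilityMeasure ν] {a : ℕ → ℝ}
    (ha : Monotone a) (n : ℕ) :
    ∑ k ∈ Finset.range n, ν.real (Set.Ico (a k) (a (k + 2))) ≤ 2 := by
  have key : ∀ b : ℕ → ℝ, Monotone b → ∀ n : ℕ,
      ∑ k ∈ Finset.range n, ν.real (Set.Ico (b k) (b (k + 1))) ≤ 1 := by
    intro b hb n
    have : ∑ k ∈ Finset.range n, ν.real (Set.Ico (b k) (b (k + 1)))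
        = ν.real (Set.Ico (b 0) (b n)) := by
      induction n with
      | zero => simp
      | succ n ih =>
        rw [Finset.sum_range_succ, ih, ← Set.Ico_union_Ico_eq_Ico (hb (Nat.zero_le n))
          (hb (Nat.le_succ n)), measureReal_union]
        · exact Set.disjoint_left.2 fun x hx hx' => absurd hx.2 (not_lt.2 hx'.1)
        · exact measurableSet_Ico
    rw [this]
    exact measureReal_le_one
  calc ∑ k ∈ Finset.range n, ν.real (Set.Ico (a k) (a (k + 2)))
      ≤ ∑ k ∈ Finset.range n, (ν.real (Set.Ico (a k) (a (k + 1)))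
          + ν.real (Set.Ico (a (k + 1)) (a (k + 1 + 1)))) := by
        refine Finset.sum_le_sum fun k _ => ?_
        rw [show k + 2 = k + 1 + 1 from rfl,
          ← Set.Ico_union_Ico_eq_Ico (ha (Nat.le_succ k)) (ha (Nat.le_succ (k + 1)))]
        exact measureReal_union_le _ _
    _ ≤ 1 + 1 := by
        rw [Finset.sum_add_distrib]
        exact add_le_add (key a ha n)
          (key (fun k => a (k + 1)) (fun i j h => ha (Nat.succ_le_succ h)) n)
    _ = 2 := by norm_num

namespace GoodSys

variable {S : Setting} {L r : ℝ} {n N : ℕ} {A V : ℕ → ℝ} {Sf : ℝ → ℝ}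
  (h : GoodSys S L r n N A V Sf)

include h

lemma load_near_zero (hr : 0 < r) (hL : 1 < L) {m : ℕ} (hm : m ≤ ⌊r * S.T⌋₊) {t : ℝ}
    (ht : t ∈ Set.Icc 0 L) :
    load N A V Sf (fun y => if y < S.κseq n then 1 else 0) (r * (m + t)) ≤ r * S.εseq n := by
  have hκ := S.hκ n
  have hl := S.hl n
  have hM := S.hM
  have hε := S.hε n
  have hκl := S.hκl n
  have hν := S.hν
  have hε0 := hε.1
  set κ := S.κseq n
  set l := S.lseq n
  set M := S.M
  set ε := S.εseq n
  have hmr : (m:ℝ) ≤ ⌊r * S.T⌋₊ := by exact_mod_cast hm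
  have hrep : ∀ a ∈ Set.Icc 0 (r * (m + t)), ∃ m' : ℕ, m' ≤ ⌊r * S.T⌋₊ ∧
      ∃ t' ∈ Set.Icc 0 L, a = r * (m' + t') := by
    intro a ha
    have ha0 : 0 ≤ a / r := div_nonneg ha.1 hr.le
    have ha1 : a / r ≤ m + t := by rw [div_le_iff₀ hr, mul_comm]; exact ha.2
    have hra : r * (a / r) = a := by field_simp
    rcases le_total (⌊r * S.T⌋₊ : ℝ) (a / r) with hc | hc
    · exact ⟨_, le_rfl, a / r - ⌊r * S.T⌋₊, ⟨by linarith, by linarith [ht.2]⟩,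
        by rw [add_sub_cancel, hra]⟩
    · refine ⟨⌊a / r⌋₊, ?_, a / r - ⌊a / r⌋₊, ⟨by linarith [Nat.floor_le ha0],
        by linarith [Nat.lt_floor_add_one (a / r)]⟩, by rw [add_sub_cancel, hra]⟩
      exact_mod_cast (Nat.floor_le ha0).trans hc
  set K : ℕ := ⌈64 * M ^ 2 / (κ * ε ^ 2)⌉₊ + 1 with hK
  have key := h.toJobSys.load_near_zero_le (κ := κ) (δ := r * l) (D := 4 * M / ε)
    (B := r * (ε / 16)) (B0 := r * (ε / 4)) (X := r * M) (M' := r * M) (u := r * (m + t)) (N := K)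
    (c := fun k : ℕ =>
      r * ((ε / 8) * (S.ν (Set.Ico (((k:ℝ) - 1/2) * κ) (((k:ℝ) + 3/2) * κ))).toReal))
    hκ (by positivity) (by have := ht.1; positivity)
    (mul_le_mul_of_nonneg_left (by linarith [ht.2]) hr.le)
    (fun a ha => by
      obtain ⟨m', hm', t', ht', rfl⟩ := hrep a ha
      exact h.load_one_le m' hm' t' ht')
    (by
      rw [lt_div_iff₀ (by positivity)] at hκl
      rw [mul_div_mul_left _ _ hr.ne', le_div_iff₀ (by positivity)]
      linarith)
    (fun a ha => by
      obtain ⟨m', hm', t', ht', rfl⟩ := hrep a ha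
      exact h.load_id_le m' hm' t' ht')
    (by positivity) (by positivity)
    (fun a ha => by
      obtain ⟨m', hm', t', ht', rfl⟩ := hrep a ha
      rw [← mul_add]
      exact h.inflow_one_le m' hm' t' ht')
    h.load_zero_le
    (by
      have h1 : 64 * M ^ 2 / (κ * ε ^ 2) ≤ ⌈64 * M ^ 2 / (κ * ε ^ 2)⌉₊ := Nat.le_ceil _
      rw [div_le_iff₀ (by positivity)] at h1
      have h2 : 4 * M / ε ≤ ⌈64 * M ^ 2 / (κ * ε ^ 2)⌉₊ * κ := by
        rw [div_le_iff₀ hε0]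
        have h3 : 4 * M * ε ≤ 64 * M ^ 2 := by nlinarith [hε.2]
        have h4 : 4 * M * ε ≤ ((⌈64 * M ^ 2 / (κ * ε ^ 2)⌉₊ * κ) * ε) * ε := by
          calc _ ≤ _ := h3
            _ ≤ _ := h1
            _ = _ := by ring
        exact le_of_mul_le_mul_right h4 hε0
      rw [hK]; push_cast; linarith)
    (fun k => by positivity)
    (fun a ha k hk => by
      obtain ⟨m', hm', t', ht', rfl⟩ := hrep a ha
      rw [← mul_add]
      exact h.inflow_window_le m' hm' t' ht' k hk)
  refine key.trans ?_
  have hsum : ∑ k ∈ Finset.range (K + 1),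
      (S.ν (Set.Ico (((k:ℝ) - 1/2) * κ) (((k:ℝ) + 3/2) * κ))).toReal ≤ 2 := by
    have := sum_measureReal_Ico_add_two_le S.ν (a := fun k : ℕ => ((k:ℝ) - 1/2) * κ)
      (fun i j hij => by
        have : (i:ℝ) ≤ j := by exact_mod_cast hij
        dsimp only
        gcongr) (K + 1)
    refine le_trans (le_of_eq (Finset.sum_congr rfl fun k _ => ?_)) this
    rw [Measure.real]
    push_cast
    rw [show (k:ℝ) + 2 - 1 / 2 = k + 3 / 2 by ring]
  rw [← Finset.mul_sum, ← Finset.mul_sum]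
  have e1 : r * M / (4 * M / ε) = r * (ε / 4) := by field_simp
  rw [e1, max_self]
  have : r * (ε / 8 * ∑ k ∈ Finset.range (K + 1),
      (S.ν (Set.Ico (((k:ℝ) - 1/2) * κ) (((k:ℝ) + 3/2) * κ))).toReal) ≤ r * (ε / 8 * 2) := by
    gcongr
  nlinarith [mul_pos hr hε0]

lemma abs_inflow_test_sub_le (hr : 0 < r) {k : ℕ} (hk : k ≤ n) {C : ℝ} (hC : ∀ x, |S.V k x| ≤ C)
    {m : ℕ} (hm : m ≤ ⌊r * S.T⌋₊) {t : ℝ} (ht : t ∈ Set.Icc 0 L) :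
    |(1 / r) * inflow N A V (S.V k) (r * m) (r * (m + t)) - S.α * t * pair (S.V k) S.ν|
      ≤ S.εseq n * (1 + C) := by
  have hl := S.hl n
  have hε := (S.hε n).1
  have hα := S.hα
  have hlε := S.hlε n
  have hν := S.hν
  set l := S.lseq n
  set ε := S.εseq n
  set j := ⌊t / l⌋₊ with hj
  have hC0 : 0 ≤ C := (abs_nonneg _).trans (hC 0)
  have hjt : (j:ℝ) * l ≤ t := by
    rw [← le_div_iff₀ hl]; exact Nat.floor_le (div_nonneg ht.1 hl.le)
  have htj : t < (j:ℝ) * l + l := by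
    have := Nat.lt_floor_add_one (t / l)
    rw [div_lt_iff₀ hl] at this
    linarith
  have hjl0 : 0 ≤ (j:ℝ) * l := by positivity
  have hmr : (m:ℝ) ≤ ⌊r * S.T⌋₊ := by exact_mod_cast hm
  rw [← inflow_add (S.V k) (b := r * (m + j * l))
    (mul_le_mul_of_nonneg_left (by linarith) hr.le)
    (mul_le_mul_of_nonneg_left (by linarith) hr.le)]
  have h1 : |(1 / r) * inflow N A V (S.V k) (r * m) (r * (m + j * l))
      - S.α * j * l * pair (S.V k) S.ν| ≤ ε := by
    rcases Nat.eq_zero_or_pos j with h0 | h0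
    · rw [h0]
      have : inflow N A V (S.V k) (r * m) (r * m) = 0 :=
        Finset.sum_eq_zero fun i _ => if_neg fun h' => absurd h'.1 (not_lt.2 h'.2)
      simp [this, hε.le]
    · exact h.inflow_test k hk j h0 (Nat.floor_le_floor (div_le_div_of_nonneg_right ht.2 hl.le)) m hm
  have h2 : |inflow N A V (S.V k) (r * (m + j * l)) (r * (m + t))| ≤ C * (r * (ε / 16)) := by
    refine (abs_inflow_le hC _ _).trans (mul_le_mul_of_nonneg_left ?_ hC0)
    exact (inflow_one_mono (mul_le_mul_of_nonneg_left (by linarith) hr.le)).trans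
      (h.inflow_one_le m hm (j * l) ⟨hjl0, hjt.trans ht.2⟩)
  have h3 : |pair (S.V k) S.ν| ≤ C := by
    have := norm_integral_le_of_norm_le_const (μ := S.ν) (f := S.V k) (C := C)
      (Filter.Eventually.of_forall hC)
    simpa [pair] using this
  have h4 : |(1 / r) * inflow N A V (S.V k) (r * (m + j * l)) (r * (m + t))| ≤ C * ε / 16 := by
    rw [abs_mul, abs_of_pos (by positivity : 0 < 1 / r), one_div, inv_mul_le_iff₀ hr]
    linarith
  have h5 : |S.α * (t - j * l) * pair (S.V k) S.ν| ≤ C * ε / 32 := by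
    rw [abs_mul, abs_of_nonneg (mul_nonneg hα.le (by linarith))]
    rw [lt_div_iff₀ (by positivity)] at hlε
    have h6 : S.α * (t - j * l) ≤ ε / 32 := by nlinarith
    calc _ ≤ ε / 32 * C := mul_le_mul h6 h3 (abs_nonneg _) (by positivity)
      _ = _ := by ring
  have e : (1 / r) * (inflow N A V (S.V k) (r * m) (r * (m + j * l))
        + inflow N A V (S.V k) (r * (m + j * l)) (r * (m + t))) - S.α * t * pair (S.V k) S.ν
      = ((1 / r) * inflow N A V (S.V k) (r * m) (r * (m + j * l))
          - S.α * j * l * pair (S.V k) S.ν)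
        + (1 / r) * inflow N A V (S.V k) (r * (m + j * l)) (r * (m + t))
        - S.α * (t - j * l) * pair (S.V k) S.ν := by ring
  rw [e]
  refine (abs_sub _ _).trans ((add_le_add (abs_add_le _ _) le_rfl).trans ?_)
  have : 0 ≤ C * ε := by positivity
  linarith

end GoodSys

/-- Quantitative properties at level `n` of a fluid scaled path. -/
structure Setting.GoodFluid (S : Setting) (L : ℝ) (n : ℕ) (ζ : ℝ → Measure ℝ) : Prop where
  finite : ∀ t ∈ Set.Icc (0:ℝ) L, IsFiniteMeasure (ζ t)
  apply_Iic : ∀ t ∈ Set.Icc (0:ℝ) L, ζ t (Set.Iic 0) = 0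
  integrable : ∀ t ∈ Set.Icc (0:ℝ) L, ∀ f : ℝ → ℝ, Integrable f (ζ t)
  mass_le : ∀ t ∈ Set.Icc (0:ℝ) L, mass (ζ t) ≤ S.M
  pair_id_le : ∀ t ∈ Set.Icc (0:ℝ) L, pair id (ζ t) ≤ S.M
  pair_pow_le : ∀ t ∈ Set.Icc (0:ℝ) L, pair (fun x => x ^ ((1:ℝ) + S.p)) (ζ t) ≤ S.M
  pair_id_sub_le : ∀ t ∈ Set.Icc (0:ℝ) L, |pair id (ζ t) - pair id (ζ 0)| ≤ S.γseq n / 4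
  pair_near_zero_le : ∀ t ∈ Set.Icc (0:ℝ) L,
    pair (fun y => if y < S.κseq n then 1 else 0) (ζ t) ≤ S.εseq n
  intervalIntegrable : ∀ k, ∀ t ∈ Set.Icc (0:ℝ) L,
    IntervalIntegrable (fun s => pair (deriv (S.V k)) (ζ s) / mass (ζ s)) volume 0 t
  evolution : ∀ k ≤ n, ∀ C, (∀ x, |S.V k x| ≤ C) → ∀ t ∈ Set.Icc (0:ℝ) L,
    |pair (S.V k) (ζ t) - pair (S.V k) (ζ 0)
      + (∫ s in (0:ℝ)..t, pair (deriv (S.V k)) (ζ s) / mass (ζ s))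
      - S.α * t * pair (S.V k) S.ν| ≤ S.εseq n * (1 + C)

lemma Setting.exists_abs_deriv_V_le (S : Setting) (k : ℕ) : ∃ C, ∀ x, |deriv (S.V k) x| ≤ C := by
  obtain ⟨C, hC⟩ := ((S.hVsupp k).deriv).exists_bound_of_continuous
    ((S.hVdiff k).continuous_deriv le_rfl)
  exact ⟨C, hC⟩

lemma Setting.memBLr.goodFluid {S : Setting} {L r : ℝ} {ζ : ℝ → Measure ℝ}
    (hζ : S.memBLr L r ζ) (hr : 0 < r) (hL : 1 < L) {n : ℕ} (hn : n ≤ S.nIdx r) :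
    S.GoodFluid L n ζ := by
  obtain ⟨N, A, V, Sf, m, h, hm, hζ⟩ := hζ.exists_goodSys hr hL hn
  have hpair : ∀ t ∈ Set.Icc (0:ℝ) L, ∀ f, pair f (ζ t) = (1 / r) * load N A V Sf f (r * (m + t)) :=
    fun t ht f => ((hζ t ht).2.2 f).2
  have hr' : ∀ x y : ℝ, (1 / r) * x ≤ y ↔ x ≤ r * y := fun x y => by
    rw [one_div, inv_mul_le_iff₀ hr]
  have h0 : (0:ℝ) ∈ Set.Icc (0:ℝ) L := ⟨le_rfl, by linarith⟩
  have hmr : (m:ℝ) ≤ ⌊r * S.T⌋₊ := by exact_mod_cast hm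
  have hl := S.hl n
  have hquot : ∀ k, ∀ s ∈ Set.Icc (0:ℝ) L, pair (deriv (S.V k)) (ζ s) / mass (ζ s) =
      load N A V Sf (deriv (S.V k)) (r * m + r * s)
        * (load N A V Sf (fun _ => 1) (r * m + r * s))⁻¹ := by
    intro k s hs
    rw [mass_eq_pair, hpair s hs, hpair s hs, mul_div_mul_left _ _ (by positivity), ← mul_add,
      div_eq_mul_inv]
  have hmeas : ∀ k, Measurable (deriv (S.V k)) := fun k => measurable_deriv _
  refine ⟨fun t ht => (hζ t ht).1, fun t ht => (hζ t ht).2.1, fun t ht f => ((hζ t ht).2.2 f).1,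
    ?_, ?_, ?_, ?_, ?_, ?_, ?_⟩
  · intro t ht
    rw [mass_eq_pair, hpair t ht, hr']
    exact h.load_one_le m hm t ht
  · intro t ht
    rw [hpair t ht, hr']
    exact h.load_id_le m hm t ht
  · intro t ht
    rw [hpair t ht, hr']
    exact h.load_pow_le m hm t ht
  · intro t ht
    rw [hpair t ht, hpair 0 h0, add_zero, ← mul_sub, abs_mul,
      abs_of_pos (by positivity : 0 < 1 / r), hr']
    exact h.load_id_sub_le m hm t ht
  · intro t ht
    rw [hpair t ht, hr']
    exact h.load_near_zero hr hL hm ht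
  · intro k t ht
    obtain ⟨C, hC⟩ := S.exists_abs_deriv_V_le k
    have h1 := h.toJobSys.intervalIntegrable_mul (hmeas k) hC (a := r * m) (b := r * m + r * t)
      (by positivity) (by have := mul_nonneg hr.le ht.1; linarith)
      (by rw [← mul_add]; exact mul_le_mul_of_nonneg_left (by linarith [ht.2]) hr.le)
    have h2 := (h1.comp_add_left (r * m)).comp_mul_left (c := r)
    have e1 : (r * m - r * m) / r = 0 := by simp
    have e2 : (r * m + r * t - r * m) / r = t := by field_simp; ring
    rw [e1, e2] at h2
    refine h2.congr ?_
    intro s hs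
    rw [Set.uIoc_of_le ht.1] at hs
    exact (hquot k s ⟨hs.1.le, hs.2.trans ht.2⟩).symm
  · intro k hk C hC t ht
    obtain ⟨C', hC'⟩ := S.exists_abs_deriv_V_le k
    have hd : ∀ x, HasDerivAt (S.V k) (deriv (S.V k) x) x := fun x =>
      ((S.hVdiff k).differentiable one_ne_zero x).hasDerivAt
    have h1 := h.toJobSys.evolution hd (hmeas k) hC' (S.hV0 k).1 (S.hV0 k).2
      (a := r * m) (b := r * m + r * t)
      (by positivity) (by have := mul_nonneg hr.le ht.1; linarith)
      (by rw [← mul_add]; exact mul_le_mul_of_nonneg_left (by linarith [ht.2]) hr.le)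
    have h2 : ∫ s in (0:ℝ)..t, pair (deriv (S.V k)) (ζ s) / mass (ζ s) =
        (1 / r) * ∫ s in (r * m)..(r * m + r * t), load N A V Sf (deriv (S.V k)) s
          * (load N A V Sf (fun _ => 1) s)⁻¹ := by
      have := intervalIntegral.smul_integral_comp_add_mul (a := 0) (b := t)
        (fun s => load N A V Sf (deriv (S.V k)) s * (load N A V Sf (fun _ => 1) s)⁻¹) r (r * m)
      rw [mul_zero, add_zero] at this
      rw [← this, smul_eq_mul, ← mul_assoc, one_div_mul_cancel hr.ne', one_mul]
      refine intervalIntegral.integral_congr fun s hs => ?_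
      rw [Set.uIcc_of_le ht.1] at hs
      exact hquot k s ⟨hs.1, hs.2.trans ht.2⟩
    have h3 := h.abs_inflow_test_sub_le hr hk hC hm ht
    rw [hpair t ht, hpair 0 h0, h2, add_zero]
    rw [mul_add r] at h3 ⊢
    rw [h1]
    refine le_of_eq_of_le (congrArg _ ?_) h3
    ring


open Topology

lemma MetricFamilies.tendsto_pair {g h : ℕ → ℝ → ℝ} (hgh : MetricFamilies g h)
    {ζs : ℕ → Measure ℝ} {ζ : Measure ℝ} (hfs : ∀ j, IsFiniteMeasure (ζs j))
    (hf : IsFiniteMeasure ζ) (h0s : ∀ j, ζs j (Set.Iio 0) = 0) (h0 : ζ (Set.Iio 0) = 0)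
    (hd : ∀ ε : ℝ, 0 < ε → ∀ᶠ j in atTop, dmet g h (ζs j) ζ ≤ ε)
    {f : ℝ → ℝ} (hfc : Continuous f) (hfb : ∃ C, ∀ x, |f x| ≤ C) :
    Tendsto (fun j => pair f (ζs j)) atTop (𝓝 (pair f ζ)) := by
  refine hgh.2.2 ζs ζ hfs hf h0s h0 (fun k => ?_) f hfc hfb
  have hle : ∀ j, (2:ℝ)⁻¹ ^ (k + 1) * min |pair (g k) (ζs j) - pair (g k) ζ| 1
      ≤ dmet g h (ζs j) ζ := by
    intro j
    have hsum : Summable fun k : ℕ =>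
        (2:ℝ)⁻¹ ^ (k + 1) * min |pair (g k) (ζs j) - pair (g k) ζ| 1 := by
      refine Summable.of_nonneg_of_le (fun k => by positivity)
        (fun k => mul_le_of_le_one_right (by positivity) (min_le_right _ _)) ?_
      exact (summable_nat_add_iff 1).2
        (summable_geometric_of_lt_one (by norm_num : (0:ℝ) ≤ 2⁻¹) (by norm_num))
    have h1 := hsum.le_tsum k fun i _ => by positivity
    have h2 : 0 ≤ ⨆ k : ℕ, |pair (h k) (ζs j) - pair (h k) ζ| :=
      Real.iSup_nonneg fun i => abs_nonneg _
    exact h1.trans (le_add_of_nonneg_right h2)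
  rw [Metric.tendsto_nhds]
  intro ε hε
  have h2 : (0:ℝ) < 2⁻¹ ^ (k + 1) := by positivity
  have hm : 0 < min ε 1 := lt_min hε one_pos
  filter_upwards [hd (2⁻¹ ^ (k + 1) * (min ε 1 / 2)) (by positivity)] with j hj
  have h3 := le_of_mul_le_mul_left ((hle j).trans hj) h2
  have h4 : min |pair (g k) (ζs j) - pair (g k) ζ| 1 < min ε 1 := h3.trans_lt (by linarith)
  rw [Real.dist_eq]
  rcases min_lt_iff.1 h4 with h5 | h5
  · exact h5.trans_le (min_le_left _ _)
  · exact absurd h5 (not_lt.2 (min_le_right _ _))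

lemma Setting.eventually_le_nIdx (S : Setting) (n : ℕ) : ∀ᶠ r in atTop, n ≤ S.nIdx r := by
  filter_upwards [eventually_gt_atTop (S.rseq n)] with r hr
  obtain ⟨k, hk⟩ := (S.hrtop.eventually_gt_atTop r).exists
  refine le_csSup ⟨k, fun i hi => ?_⟩ hr
  exact (S.hrmono.lt_iff_lt.1 (lt_trans (show S.rseq i < r from hi) hk)).le

/-- `ζ` is the weak limit on `[0, L]` of fluid scaled paths which are good up to level `n`. -/
structure Setting.FluidLimit (S : Setting) (L : ℝ) (ξ : ℕ → ℝ → Measure ℝ)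
    (ζ : ℝ → Measure ℝ) : Prop where
  good : ∀ n, ∀ k ≤ n, S.GoodFluid L k (ξ n)
  finite : ∀ t ∈ Set.Icc (0:ℝ) L, IsFiniteMeasure (ζ t)
  apply_Iio : ∀ t ∈ Set.Icc (0:ℝ) L, ζ t (Set.Iio 0) = 0
  tendsto : ∀ t ∈ Set.Icc (0:ℝ) L, ∀ f : ℝ → ℝ, Continuous f → (∃ C, ∀ x, |f x| ≤ C) →
    Tendsto (fun n => pair f (ξ n t)) atTop (𝓝 (pair f (ζ t)))
  continuousOn : WeaklyContinuousOn ζ (Set.Icc 0 L)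

lemma Setting.memBL.exists_fluidLimit {S : Setting} {L : ℝ} (hL : 1 < L) {ζ : ℝ → Measure ℝ}
    (hζ : S.memBL L ζ) : ∃ ξ, S.FluidLimit L ξ ζ := by
  obtain ⟨hfin, hcont, φ, ζs, hφ, hmem, hlim⟩ := hζ
  have hRφ : Tendsto (fun j => S.R (φ j)) atTop atTop := S.hRtop.comp hφ.tendsto_atTop
  have hev : ∀ n : ℕ, ∃ j, n ≤ j ∧ n ≤ S.nIdx (S.R (φ j)) := fun n =>
    ((eventually_ge_atTop n).and (hRφ.eventually (S.eventually_le_nIdx n))).exists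
  choose J hJ1 hJ2 using hev
  have hgood : ∀ n, ∀ k ≤ n, S.GoodFluid L k (ζs (J n)) := fun n k hk =>
    (hmem (J n)).goodFluid (S.hR _) hL (hk.trans (hJ2 n))
  refine ⟨fun n => ζs (J n), hgood, fun t ht => (hfin t ht).1, fun t ht => (hfin t ht).2, ?_, ?_⟩
  · intro t ht f hf hb
    refine S.hmetfam.tendsto_pair (fun n => (hgood n n le_rfl).finite t ht) (hfin t ht).1
      (fun n => measure_mono_null Set.Iio_subset_Iic_self ((hgood n n le_rfl).apply_Iic t ht))
      (hfin t ht).2 (fun ε hε => ?_) hf hb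
    obtain ⟨J0, hJ0⟩ := hlim ε hε
    filter_upwards [eventually_ge_atTop J0] with n hn
    exact hJ0 _ (hn.trans (hJ1 n)) t ht
  · intro f hf hb t ht
    rw [ContinuousWithinAt, tendsto_iff_seq_tendsto]
    intro x hx
    rw [tendsto_nhdsWithin_iff] at hx
    obtain ⟨hx1, hx2⟩ := hx
    obtain ⟨n0, hn0⟩ := eventually_atTop.1 hx2
    rw [← tendsto_add_atTop_iff_nat n0]
    have hmem' : ∀ n, x (n + n0) ∈ Set.Icc (0:ℝ) L := fun n => hn0 _ (Nat.le_add_left _ _)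
    refine S.hmetfam.tendsto_pair (ζs := fun n => ζ (x (n + n0)))
      (fun n => (hfin _ (hmem' n)).1) (hfin t ht).1
      (fun n => (hfin _ (hmem' n)).2) (hfin t ht).2 (fun ε hε => ?_) hf hb
    obtain ⟨δ, hδ, hδ'⟩ := hcont t ht ε hε
    filter_upwards [((tendsto_add_atTop_iff_nat n0).2 hx1).eventually (Metric.ball_mem_nhds t hδ)]
      with n hn
    exact (hδ' _ (hmem' n) hn).le

lemma integrable_of_integral_min_le {μ : Measure ℝ} [IsFiniteMeasure μ] {F : ℝ → ℝ}
    (hF : Continuous F) (hF0 : ∀ x, 0 ≤ F x) {M : ℝ} (hM : ∀ K : ℕ, ∫ x, min (F x) K ∂μ ≤ M) :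
    Integrable F μ ∧ ∫ x, F x ∂μ ≤ M := by
  have hM0 : 0 ≤ M := le_trans (integral_nonneg fun x => le_min (hF0 x) (Nat.cast_nonneg 0)) (hM 0)
  have hInt : ∀ K : ℕ, Integrable (fun x => min (F x) K) μ := fun K =>
    Integrable.of_bound (C := K) (by fun_prop) (Filter.Eventually.of_forall fun x => by
      rw [Real.norm_of_nonneg (le_min (hF0 x) (Nat.cast_nonneg K))]
      exact min_le_right _ _)
  have hle : ∫⁻ x, ENNReal.ofReal (F x) ∂μ ≤ ENNReal.ofReal M := by
    refine le_of_tendsto' (lintegral_tendsto_of_tendsto_of_monotone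
      (f := fun (K : ℕ) x => ENNReal.ofReal (min (F x) K)) (μ := μ) (fun K => by fun_prop) ?_ ?_) ?_
    · refine Filter.Eventually.of_forall fun x i j hij => ENNReal.ofReal_le_ofReal ?_
      have : (i:ℝ) ≤ j := by exact_mod_cast hij
      exact min_le_min_left _ this
    · refine Filter.Eventually.of_forall fun x => tendsto_const_nhds.congr' ?_
      obtain ⟨K, hK⟩ := exists_nat_ge (F x)
      filter_upwards [eventually_ge_atTop K] with j hj
      have : (K:ℝ) ≤ j := by exact_mod_cast hj
      rw [min_eq_left (hK.trans this)]
    · intro K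
      rw [← ofReal_integral_eq_lintegral_ofReal (hInt K)
        (Filter.Eventually.of_forall fun x => le_min (hF0 x) (Nat.cast_nonneg K))]
      exact ENNReal.ofReal_le_ofReal (hM K)
  have hI : Integrable F μ := by
    refine ⟨hF.aestronglyMeasurable, ?_⟩
    rw [hasFiniteIntegral_iff_ofReal (Filter.Eventually.of_forall hF0)]
    exact hle.trans_lt ENNReal.ofReal_lt_top
  refine ⟨hI, ?_⟩
  rw [integral_eq_lintegral_of_nonneg_ae (Filter.Eventually.of_forall hF0)
    hF.aestronglyMeasurable]
  exact ENNReal.toReal_le_of_le_ofReal hM0 hle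

lemma abs_integral_sub_integral_min_le {ρ : Measure ℝ} [IsFiniteMeasure ρ] {p M K : ℝ}
    (hp : 0 < p) (hK : 0 < K)
    (h0 : ρ (Set.Iio 0) = 0) (hid : Integrable id ρ)
    (hpow : Integrable (fun x => (max x 0) ^ ((1:ℝ) + p)) ρ)
    (hM : ∫ x, (max x 0) ^ ((1:ℝ) + p) ∂ρ ≤ M) :
    |pair id ρ - pair (fun x => min (max x 0) K) ρ| ≤ M * K ^ (-p) := by
  have hInt : Integrable (fun x : ℝ => min (max x 0) K) ρ :=
    Integrable.of_bound (C := K) (by fun_prop) (Filter.Eventually.of_forall fun x => by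
      rw [Real.norm_of_nonneg (le_min (le_max_right _ _) hK.le)]
      exact min_le_right _ _)
  have hpos : ∀ᵐ x ∂ρ, 0 ≤ x := by
    rw [ae_iff]; simpa [Set.Iio] using h0
  rw [pair, pair, ← integral_sub hid hInt, ← Real.norm_eq_abs]
  refine (norm_integral_le_of_norm_le (hpow.mul_const (K ^ (-p))) ?_).trans ?_
  · filter_upwards [hpos] with x hx
    rw [max_eq_left hx, id, Real.norm_of_nonneg (sub_nonneg.2 (min_le_left _ _))]
    rcases le_total x K with h | h
    · rw [min_eq_left h, sub_self]; positivity
    · have hx0 : 0 < x := hK.trans_le h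
      have h1 : 1 ≤ x ^ p * K ^ (-p) := by
        rw [Real.rpow_neg hK.le, ← div_eq_mul_inv, one_le_div (by positivity)]
        exact Real.rpow_le_rpow hK.le h hp.le
      rw [min_eq_right h, Real.rpow_add hx0, Real.rpow_one, mul_assoc]
      nlinarith
  · rw [integral_mul_const]
    gcongr

namespace Setting.FluidLimit

variable {S : Setting} {L : ℝ} {ξ : ℕ → ℝ → Measure ℝ} {ζ : ℝ → Measure ℝ}
  (h : S.FluidLimit L ξ ζ) {t : ℝ} (ht : t ∈ Set.Icc (0:ℝ) L)

include h ht

lemma tendsto_mass : Tendsto (fun n => mass (ξ n t)) atTop (𝓝 (mass (ζ t))) := by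
  simp only [mass_eq_pair]
  exact h.tendsto t ht _ continuous_const ⟨1, fun x => by simp⟩

lemma mass_le : mass (ζ t) ≤ S.M :=
  le_of_tendsto' (h.tendsto_mass ht) fun n => (h.good n n le_rfl).mass_le t ht

lemma integrable_integral_le {F G : ℝ → ℝ} (hF : Continuous F) (hF0 : ∀ x, 0 ≤ F x)
    (hFG : ∀ x, 0 < x → F x = G x) {C : ℝ} (hG : ∀ n, pair G (ξ n t) ≤ C) :
    Integrable F (ζ t) ∧ pair F (ζ t) ≤ C := by
  have := h.finite t ht
  refine integrable_of_integral_min_le hF hF0 fun K => ?_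
  refine le_of_tendsto' (h.tendsto t ht (fun x => min (F x) K) (by fun_prop) ⟨K, fun x => ?_⟩)
    fun n => ?_
  · rw [abs_of_nonneg (le_min (hF0 x) (Nat.cast_nonneg K))]
    exact min_le_right _ _
  · refine le_trans ?_ (hG n)
    have hn := h.good n n le_rfl
    refine integral_mono_ae (hn.integrable t ht _) (hn.integrable t ht _) ?_
    have hpos : ∀ᵐ x ∂(ξ n t), 0 < x := by
      rw [ae_iff]; simpa [Set.Iic] using hn.apply_Iic t ht
    filter_upwards [hpos] with x hx
    rw [← hFG x hx]
    exact min_le_left _ _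

lemma ae_nonneg : ∀ᵐ x ∂(ζ t), 0 ≤ x := by
  rw [ae_iff]; simpa [Set.Iio] using h.apply_Iio t ht

lemma integrable_pow : Integrable (fun x => (max x 0) ^ ((1:ℝ) + S.p)) (ζ t) ∧
    pair (fun x => (max x 0) ^ ((1:ℝ) + S.p)) (ζ t) ≤ S.M := by
  have hp := S.hp
  refine h.integrable_integral_le ht
    (Continuous.rpow_const (by fun_prop) fun x => Or.inr (by linarith)) (fun x => by positivity)
    (G := fun x => x ^ ((1:ℝ) + S.p)) (fun x hx => by rw [max_eq_left hx.le])
    fun n => (h.good n n le_rfl).pair_pow_le t ht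

lemma integrable_id : Integrable id (ζ t) ∧ pair id (ζ t) ≤ S.M := by
  obtain ⟨h1, h2⟩ := h.integrable_integral_le ht (F := fun x => max x 0) (G := id) (by fun_prop)
    (fun x => le_max_right _ _) (fun x hx => max_eq_left hx.le)
    fun n => (h.good n n le_rfl).pair_id_le t ht
  have hae : (fun x : ℝ => max x 0) =ᵐ[ζ t] id := by
    filter_upwards [h.ae_nonneg ht] with x hx
    exact max_eq_left hx
  exact ⟨h1.congr hae, (integral_congr_ae hae).symm.trans_le h2⟩

lemma pair_rpow_le {q : ℝ} (hq : 0 < q) (hqp : q ≤ S.p) :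
    pair (fun x => x ^ ((1:ℝ) + q)) (ζ t) ≤ 2 * S.M := by
  have := h.finite t ht
  obtain ⟨h1, h2⟩ := h.integrable_pow ht
  have h3 : pair (fun x => x ^ ((1:ℝ) + q)) (ζ t)
      ≤ ∫ x, (1 + (max x 0) ^ ((1:ℝ) + S.p)) ∂(ζ t) := by
    refine integral_mono_of_nonneg ?_ ((integrable_const _).add h1) ?_
    · filter_upwards [h.ae_nonneg ht] with x hx
      exact Real.rpow_nonneg hx _
    · filter_upwards [h.ae_nonneg ht] with x hx
      rw [max_eq_left hx]
      rcases le_total x 1 with hx1 | hx1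
      · have := Real.rpow_le_one hx hx1 (by linarith : 0 ≤ 1 + q)
        have := Real.rpow_nonneg hx (1 + S.p)
        linarith
      · have := Real.rpow_le_rpow_of_exponent_le hx1 (by linarith : 1 + q ≤ 1 + S.p)
        linarith
  rw [integral_add (integrable_const _) h1] at h3
  have h4 := h.mass_le ht
  rw [mass_eq_pair] at h4
  unfold pair at h2 h4
  linarith

lemma pair_id_eq (hL : 1 < L) : pair id (ζ t) = pair id (ζ 0) := by
  have h0 : (0:ℝ) ∈ Set.Icc (0:ℝ) L := ⟨le_rfl, by linarith⟩
  have hp := S.hp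
  have hcut : ∀ s ∈ Set.Icc (0:ℝ) L, ∀ K : ℝ, 0 < K →
      |pair id (ζ s) - pair (fun x => min (max x 0) K) (ζ s)| ≤ S.M * K ^ (-S.p) := by
    intro s hs K hK
    have := h.finite s hs
    exact abs_integral_sub_integral_min_le hp hK (h.apply_Iio s hs) (h.integrable_id hs).1
      (h.integrable_pow hs).1 (h.integrable_pow hs).2
  have hcut' : ∀ n, ∀ s ∈ Set.Icc (0:ℝ) L, ∀ K : ℝ, 0 < K →
      |pair id (ξ n s) - pair (fun x => min (max x 0) K) (ξ n s)| ≤ S.M * K ^ (-S.p) := by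
    intro n s hs K hK
    have hn := h.good n n le_rfl
    have := hn.finite s hs
    refine abs_integral_sub_integral_min_le hp hK
      (measure_mono_null Set.Iio_subset_Iic_self (hn.apply_Iic s hs)) (hn.integrable s hs _)
      (hn.integrable s hs _) (le_of_eq_of_le (integral_congr_ae ?_) (hn.pair_pow_le s hs))
    have hpos : ∀ᵐ x ∂(ξ n s), 0 < x := by
      rw [ae_iff]; simpa [Set.Iic] using hn.apply_Iic s hs
    filter_upwards [hpos] with x hx
    rw [max_eq_left hx.le]
  have hbound : ∀ K : ℕ, 0 < K → |pair id (ζ t) - pair id (ζ 0)| ≤ 4 * S.M * (K:ℝ) ^ (-S.p) := by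
    intro K hK
    have hK' : (0:ℝ) < K := by exact_mod_cast hK
    have hf : ∀ x : ℝ, |min (max x 0) (K:ℝ)| ≤ K := fun x => by
      rw [abs_of_nonneg (le_min (le_max_right _ _) hK'.le)]
      exact min_le_right _ _
    have hγ : Tendsto (fun n => S.γseq n / 4 + 2 * S.M * (K:ℝ) ^ (-S.p)) atTop
        (𝓝 (0 / 4 + 2 * S.M * (K:ℝ) ^ (-S.p))) := by
      refine (Tendsto.div_const ?_ 4).add_const _
      have hε : Tendsto (fun n => S.εseq n / (32 * S.α)) atTop (𝓝 0) := by
        simpa using S.hεlim.div_const (32 * S.α)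
      refine squeeze_zero (fun n => (S.hγ n).le) (fun n => ?_) hε
      have h1 := (S.hγc n).trans_le (min_le_right _ _)
      linarith [S.hlε n, S.hl n]
    have hmain : |pair (fun x => min (max x 0) (K:ℝ)) (ζ t)
        - pair (fun x => min (max x 0) (K:ℝ)) (ζ 0)| ≤ 0 / 4 + 2 * S.M * (K:ℝ) ^ (-S.p) := by
      refine le_of_tendsto_of_tendsto' ((h.tendsto t ht _ (by fun_prop) ⟨K, hf⟩).sub
        (h.tendsto 0 h0 _ (by fun_prop) ⟨K, hf⟩)).abs hγ fun n => ?_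
      have e1 := abs_le.1 (hcut' n t ht K hK')
      have e2 := abs_le.1 (hcut' n 0 h0 K hK')
      have e3 := abs_le.1 ((h.good n n le_rfl).pair_id_sub_le t ht)
      exact abs_le.2 ⟨by linarith [e1.1, e1.2, e2.1, e2.2, e3.1],
        by linarith [e1.1, e1.2, e2.1, e2.2, e3.2]⟩
    have e1 := abs_le.1 (hcut t ht K hK')
    have e2 := abs_le.1 (hcut 0 h0 K hK')
    have e3 := abs_le.1 hmain
    exact abs_le.2 ⟨by linarith [e1.1, e1.2, e2.1, e2.2, e3.1],
      by linarith [e1.1, e1.2, e2.1, e2.2, e3.2]⟩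
  have hlim : Tendsto (fun K : ℕ => 4 * S.M * (K:ℝ) ^ (-S.p)) atTop (𝓝 (4 * S.M * 0)) :=
    ((tendsto_rpow_neg_atTop hp).comp tendsto_natCast_atTop_atTop).const_mul _
  have hle : |pair id (ζ t) - pair id (ζ 0)| ≤ 4 * S.M * 0 :=
    ge_of_tendsto hlim ((eventually_gt_atTop 0).mono hbound)
  rw [mul_zero] at hle
  exact sub_eq_zero.1 (abs_eq_zero.1 (le_antisymm hle (abs_nonneg _)))

lemma apply_zero : ζ t {0} = 0 := by
  have := h.finite t ht
  have hle : ∀ k, (ζ t).real {0} ≤ S.εseq k := by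
    intro k
    have hκ := S.hκ k
    set ψ : ℝ → ℝ := fun x => max 0 (1 - |x| / S.κseq k) with hψ
    have hψc : Continuous ψ := by fun_prop
    have hψ0 : ∀ x, 0 ≤ ψ x := fun x => le_max_left _ _
    have hψ1 : ∀ x, ψ x ≤ 1 := fun x => max_le zero_le_one
      (by have : 0 ≤ |x| / S.κseq k := by positivity
          linarith)
    have hψb : ∀ x, |ψ x| ≤ 1 := fun x => by rw [abs_of_nonneg (hψ0 x)]; exact hψ1 x
    have h1 : pair ψ (ζ t) ≤ S.εseq k := by
      refine le_of_tendsto (h.tendsto t ht ψ hψc ⟨1, hψb⟩) ?_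
      filter_upwards [eventually_ge_atTop k] with n hn
      have hg := h.good n k hn
      refine le_trans (integral_mono_ae (hg.integrable t ht _) (hg.integrable t ht _) ?_)
        (hg.pair_near_zero_le t ht)
      have hpos : ∀ᵐ x ∂(ξ n t), 0 < x := by
        rw [ae_iff]; simpa [Set.Iic] using hg.apply_Iic t ht
      filter_upwards [hpos] with x hx
      split_ifs with hx'
      · exact hψ1 x
      · refine max_le le_rfl ?_
        rw [abs_of_pos hx, sub_nonpos, one_le_div hκ]
        exact not_lt.1 hx'
    refine le_trans ?_ h1
    rw [← integral_indicator_one (measurableSet_singleton (0:ℝ))]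
    refine integral_mono_of_nonneg (Filter.Eventually.of_forall fun x =>
      Set.indicator_nonneg (fun _ _ => zero_le_one) x)
      (Integrable.of_bound (C := 1) hψc.aestronglyMeasurable (Filter.Eventually.of_forall hψb))
      (Filter.Eventually.of_forall fun x => ?_)
    by_cases hx : x = 0
    · simp [hx, hψ]
    · simpa [hx] using hψ0 x
  have := ge_of_tendsto' S.hεlim hle
  exact (measureReal_eq_zero_iff).1 (le_antisymm this measureReal_nonneg)

lemma eq_zero_of_pair_id_eq_zero (h0 : pair id (ζ t) = 0) : ζ t = 0 := by
  have h1 := (integral_eq_zero_iff_of_nonneg_ae (h.ae_nonneg ht) (h.integrable_id ht).1).1 h0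
  have h2 : ∀ᵐ x ∂(ζ t), x ≠ 0 := by
    rw [ae_iff]; simpa using h.apply_zero ht
  have h3 : ∀ᵐ x ∂(ζ t), False := by
    filter_upwards [h1, h2] with x hx hx'
    exact hx' hx
  rw [ae_iff] at h3
  simpa using h3

end Setting.FluidLimit


/-- The integrated fluid equation at time `t` tested against `g`. -/
def FluidEq (α : ℝ) (ν : Measure ℝ) (ζ : ℝ → Measure ℝ) (t : ℝ) (g : ℝ → ℝ) : Prop :=
  pair g (ζ t) = pair g (ζ 0)
    - (∫ s in (0:ℝ)..t, pair (deriv g) (ζ s) / mass (ζ s)) + α * t * pair g ν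

lemma abs_pair_div_mass_le {ζ : Measure ℝ} [IsFiniteMeasure ζ] {f : ℝ → ℝ} {C : ℝ}
    (hf : ∀ x, |f x| ≤ C) : |pair f ζ / mass ζ| ≤ C := by
  have hC : 0 ≤ C := (abs_nonneg _).trans (hf 0)
  have h1 : |pair f ζ| ≤ C * mass ζ :=
    norm_integral_le_of_norm_le_const (f := f) (Filter.Eventually.of_forall hf)
  have h2 : 0 ≤ mass ζ := ENNReal.toReal_nonneg
  rw [abs_div, abs_of_nonneg h2]
  exact div_le_of_le_mul₀ h2 hC h1

lemma tendsto_pair_of_dominated {ζ : Measure ℝ} [IsFiniteMeasure ζ] {G : ℕ → ℝ → ℝ} {g : ℝ → ℝ}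
    {C : ℝ} (hG : ∀ j, Continuous (G j)) (hC : ∀ j x, |G j x| ≤ C)
    (hlim : ∀ x, Tendsto (fun j => G j x) atTop (𝓝 (g x))) :
    Tendsto (fun j => pair (G j) ζ) atTop (𝓝 (pair g ζ)) :=
  tendsto_integral_of_dominated_convergence (fun _ => C) (fun j => (hG j).aestronglyMeasurable)
    (integrable_const C) (fun j => Filter.Eventually.of_forall (hC j))
    (Filter.Eventually.of_forall hlim)

section

variable {α : ℝ} {ν : Measure ℝ} [IsFiniteMeasure ν] {ζ : ℝ → Measure ℝ} {L t : ℝ}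

lemma FluidEq.of_tendsto (hfin : ∀ s ∈ Set.Icc (0:ℝ) L, IsFiniteMeasure (ζ s))
    (hcont : WeaklyContinuousOn ζ (Set.Icc 0 L)) (hne : ∀ s ∈ Set.Icc (0:ℝ) L, mass (ζ s) ≠ 0)
    (ht : t ∈ Set.Icc (0:ℝ) L) {G : ℕ → ℝ → ℝ} {g : ℝ → ℝ} {C : ℝ}
    (hG : ∀ j, ContDiff ℝ 1 (G j)) (hC : ∀ j x, |G j x| ≤ C) (hC' : ∀ j x, |deriv (G j) x| ≤ C)
    (hlim : ∀ x, Tendsto (fun j => G j x) atTop (𝓝 (g x)))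
    (hlim' : ∀ x, Tendsto (fun j => deriv (G j) x) atTop (𝓝 (deriv g x)))
    (hEq : ∀ j, FluidEq α ν ζ t (G j)) : FluidEq α ν ζ t g := by
  have h0 : (0:ℝ) ∈ Set.Icc (0:ℝ) L := ⟨le_rfl, ht.1.trans ht.2⟩
  have hcG' : ∀ j, Continuous (deriv (G j)) := fun j => (hG j).continuous_deriv le_rfl
  have hmass : ContinuousOn (fun s => mass (ζ s)) (Set.Icc 0 L) := by
    simp only [mass_eq_pair]
    exact hcont _ continuous_const ⟨1, fun x => by simp⟩
  have hft := hfin t ht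
  have hf0 := hfin 0 h0
  have hsub : Set.uIoc 0 t ⊆ Set.Icc 0 L := fun s hs => by
    rw [Set.uIoc_of_le ht.1] at hs
    exact ⟨hs.1.le, hs.2.trans ht.2⟩
  have hInt : Tendsto (fun j => ∫ s in (0:ℝ)..t, pair (deriv (G j)) (ζ s) / mass (ζ s)) atTop
      (𝓝 (∫ s in (0:ℝ)..t, pair (deriv g) (ζ s) / mass (ζ s))) := by
    refine intervalIntegral.tendsto_integral_filter_of_dominated_convergence (fun _ => C)
      (Filter.Eventually.of_forall fun j => ?_) (Filter.Eventually.of_forall fun j => ?_)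
      intervalIntegrable_const ?_
    · exact ((((hcont _ (hcG' j) ⟨C, hC' j⟩).div hmass hne).mono hsub).aestronglyMeasurable
        measurableSet_uIoc)
    · refine Filter.Eventually.of_forall fun s hs => ?_
      have := hfin s (hsub hs)
      exact abs_pair_div_mass_le (hC' j)
    · refine Filter.Eventually.of_forall fun s hs => ?_
      have := hfin s (hsub hs)
      exact (tendsto_pair_of_dominated hcG' hC' hlim').div_const _
  have hcG := fun j => (hG j).continuous
  refine tendsto_nhds_unique (tendsto_pair_of_dominated hcG hC hlim) ?_
  rw [tendsto_congr hEq]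
  exact ((tendsto_pair_of_dominated hcG hC hlim).sub hInt).add
    ((tendsto_pair_of_dominated hcG hC hlim).const_mul _)

lemma FluidEq.of_compactSupport (hfin : ∀ s ∈ Set.Icc (0:ℝ) L, IsFiniteMeasure (ζ s))
    (hcont : WeaklyContinuousOn ζ (Set.Icc 0 L)) (hne : ∀ s ∈ Set.Icc (0:ℝ) L, mass (ζ s) ≠ 0)
    (ht : t ∈ Set.Icc (0:ℝ) L)
    (hcomp : ∀ g : ℝ → ℝ, HasCompactSupport g → ContDiff ℝ 1 g → g 0 = 0 → deriv g 0 = 0 →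
      FluidEq α ν ζ t g)
    {g : ℝ → ℝ} (hg : ContDiff ℝ 1 g) {C : ℝ} (hC : ∀ x, |g x| ≤ C) (hC' : ∀ x, |deriv g x| ≤ C)
    (h0 : g 0 = 0) (h0' : deriv g 0 = 0) : FluidEq α ν ζ t g := by
  let ψ : ContDiffBump (0:ℝ) := ⟨1, 2, one_pos, one_lt_two⟩
  have hψc : ContDiff ℝ 1 ψ := ψ.contDiff
  obtain ⟨B, hB⟩ := ψ.hasCompactSupport.deriv.exists_bound_of_continuous
    (hψc.continuous_deriv le_rfl)
  have hC0 : 0 ≤ C := (abs_nonneg _).trans (hC 0)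
  have hB0 : 0 ≤ B := (norm_nonneg _).trans (hB 0)
  have hψ1 : ∀ y, |ψ y| ≤ 1 := fun y => by rw [abs_of_nonneg ψ.nonneg]; exact ψ.le_one
  have hdiff : ∀ (j : ℕ) x, HasDerivAt (fun x => g x * ψ (x / (j + 1)))
      (deriv g x * ψ (x / (j + 1)) + g x * (deriv ψ (x / (j + 1)) * (1 / (j + 1)))) x := by
    intro j x
    have h1 := (hg.differentiable one_ne_zero x).hasDerivAt
    have h2 := (hψc.differentiable one_ne_zero (x / (j + 1))).hasDerivAt
    exact h1.mul (HasDerivAt.comp (h₂ := ψ) x h2 ((hasDerivAt_id x).div_const ((j:ℝ) + 1)))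
  have hj : ∀ j : ℕ, (0:ℝ) < j + 1 := fun j => by positivity
  have hj1 : ∀ j : ℕ, 1 / ((j:ℝ) + 1) ≤ 1 := fun j => by
    rw [div_le_one (hj j)]; linarith [(Nat.cast_nonneg j : (0:ℝ) ≤ j)]
  have hev : ∀ x : ℝ, ∀ᶠ j : ℕ in atTop, ψ (x / (j + 1)) = 1 := by
    intro x
    obtain ⟨n, hn⟩ := exists_nat_ge |x|
    filter_upwards [eventually_ge_atTop n] with j hnj
    refine ψ.one_of_mem_closedBall ?_
    have : (n:ℝ) ≤ j := by exact_mod_cast hnj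
    rw [Metric.mem_closedBall, dist_zero_right, Real.norm_eq_abs, abs_div, abs_of_pos (hj j),
      div_le_iff₀ (hj j)]
    change |x| ≤ 1 * _
    linarith
  have hsecond : ∀ (j : ℕ) x,
      |g x * (deriv ψ (x / (j + 1)) * (1 / (j + 1)))| ≤ C * B * (1 / (j + 1)) := by
    intro j x
    rw [abs_mul, abs_mul, abs_of_pos (by have := hj j; positivity : (0:ℝ) < 1 / (j + 1)), ← mul_assoc]
    have := hj j
    gcongr
    · exact hC x
    · exact hB _
  refine FluidEq.of_tendsto hfin hcont hne ht (G := fun j x => g x * ψ (x / (j + 1)))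
    (C := C + C * B) (fun j => hg.mul (hψc.comp (by fun_prop))) ?_ ?_ ?_ ?_ fun j => ?_
  · intro j x
    rw [abs_mul]
    have := mul_le_mul (hC x) (hψ1 (x / (j + 1))) (abs_nonneg _) hC0
    have : 0 ≤ C * B := by positivity
    linarith
  · intro j x
    rw [(hdiff j x).deriv]
    refine (abs_add_le _ _).trans (add_le_add ?_ ((hsecond j x).trans ?_))
    · rw [abs_mul]
      have := mul_le_mul (hC' x) (hψ1 (x / (j + 1))) (abs_nonneg _) hC0
      linarith
    · exact mul_le_of_le_one_right (by positivity) (hj1 j)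
  · intro x
    refine tendsto_const_nhds.congr' ?_
    filter_upwards [hev x] with j hx
    rw [hx, mul_one]
  · intro x
    have e : ∀ j : ℕ, deriv (fun x => g x * ψ (x / (j + 1))) x =
        deriv g x * ψ (x / (j + 1)) + g x * (deriv ψ (x / (j + 1)) * (1 / (j + 1))) :=
      fun j => (hdiff j x).deriv
    simp only [e]
    rw [← add_zero (deriv g x)]
    refine Tendsto.add ?_ ?_
    · rw [add_zero]
      refine tendsto_const_nhds.congr' ?_
      filter_upwards [hev x] with j hx
      rw [hx, mul_one]
    · refine squeeze_zero_norm (fun j => hsecond j x) ?_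
      simpa using (tendsto_one_div_add_atTop_nhds_zero_nat (𝕜 := ℝ)).const_mul (C * B)
  · refine hcomp _ ?_ (hg.mul (hψc.comp (by fun_prop))) (by simp [h0]) ?_
    · refine HasCompactSupport.intro (isCompact_closedBall (0:ℝ) (2 * (j + 1))) fun x hx => ?_
      rw [ψ.zero_of_le_dist, mul_zero]
      rw [Metric.mem_closedBall, dist_zero_right, Real.norm_eq_abs, not_le] at hx
      rw [dist_zero_right, Real.norm_eq_abs, abs_div, abs_of_pos (hj j), le_div_iff₀ (hj j)]
      exact hx.le
    · rw [(hdiff j 0).deriv, h0, h0']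
      ring

end

namespace Setting.FluidLimit

variable {S : Setting} {L : ℝ} {ξ : ℕ → ℝ → Measure ℝ} {ζ : ℝ → Measure ℝ}
  (h : S.FluidLimit L ξ ζ)

include h

lemma fluidEq_V (hne : ∀ s ∈ Set.Icc (0:ℝ) L, mass (ζ s) ≠ 0) {t : ℝ}
    (ht : t ∈ Set.Icc (0:ℝ) L) (k : ℕ) : FluidEq S.α S.ν ζ t (S.V k) := by
  have h0 : (0:ℝ) ∈ Set.Icc (0:ℝ) L := ⟨le_rfl, ht.1.trans ht.2⟩
  obtain ⟨C, hC⟩ := (S.hVsupp k).exists_bound_of_continuous (S.hVdiff k).continuous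
  obtain ⟨C', hC'⟩ := S.exists_abs_deriv_V_le k
  have hsub : Set.uIoc 0 t ⊆ Set.Icc 0 L := fun s hs => by
    rw [Set.uIoc_of_le ht.1] at hs
    exact ⟨hs.1.le, hs.2.trans ht.2⟩
  have hInt : Tendsto (fun n => ∫ s in (0:ℝ)..t, pair (deriv (S.V k)) (ξ n s) / mass (ξ n s)) atTop
      (𝓝 (∫ s in (0:ℝ)..t, pair (deriv (S.V k)) (ζ s) / mass (ζ s))) := by
    refine intervalIntegral.tendsto_integral_filter_of_dominated_convergence (fun _ => C')
      (Filter.Eventually.of_forall fun n => ?_) (Filter.Eventually.of_forall fun n => ?_)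
      intervalIntegrable_const ?_
    · rw [Set.uIoc_of_le ht.1]
      exact ((h.good n n le_rfl).intervalIntegrable k t ht).aestronglyMeasurable
    · refine Filter.Eventually.of_forall fun s hs => ?_
      have := (h.good n n le_rfl).finite s (hsub hs)
      exact abs_pair_div_mass_le hC'
    · refine Filter.Eventually.of_forall fun s hs => ?_
      exact (h.tendsto s (hsub hs) _ ((S.hVdiff k).continuous_deriv le_rfl) ⟨C', hC'⟩).div
        (h.tendsto_mass (hsub hs)) (hne s (hsub hs))
  have hV := fun s hs => h.tendsto s hs (S.V k) (S.hVdiff k).continuous ⟨C, hC⟩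
  have hlim := ((((hV t ht).sub (hV 0 h0)).add hInt).sub_const
    (S.α * t * pair (S.V k) S.ν)).abs
  have hzero : Tendsto (fun n => S.εseq n * (1 + C)) atTop (𝓝 0) := by
    simpa using S.hεlim.mul_const (1 + C)
  have := le_of_tendsto_of_tendsto hlim hzero (by
    filter_upwards [eventually_ge_atTop k] with n hn
    exact (h.good n n le_rfl).evolution k hn C hC t ht)
  have := abs_eq_zero.1 (le_antisymm this (abs_nonneg _))
  unfold FluidEq
  linarith

lemma isFluidSol (hL : 1 < L) : IsFluidSol S.α S.ν L ζ := by
  have hν := S.hν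
  have h0 : (0:ℝ) ∈ Set.Icc (0:ℝ) L := ⟨le_rfl, by linarith⟩
  refine ⟨fun t ht => ⟨h.finite t ht, h.apply_Iio t ht, h.apply_zero ht⟩, h.continuousOn, ?_⟩
  by_cases hz : ζ 0 = 0
  · refine Or.inl ⟨hz, fun t ht => h.eq_zero_of_pair_id_eq_zero ht ?_⟩
    rw [h.pair_id_eq ht hL, hz, pair, integral_zero_measure]
  · have hnz : ∀ t ∈ Set.Icc (0:ℝ) L, ζ t ≠ 0 := fun t ht ht0 => hz <| by
      refine h.eq_zero_of_pair_id_eq_zero h0 ?_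
      rw [← h.pair_id_eq ht hL, ht0, pair, integral_zero_measure]
    have hne : ∀ s ∈ Set.Icc (0:ℝ) L, mass (ζ s) ≠ 0 := fun s hs => by
      have := h.finite s hs
      exact fun h0 => hnz s hs (Measure.measure_univ_eq_zero.1 ((measureReal_eq_zero_iff).1 h0))
    refine Or.inr ⟨hnz, fun t ht g hg ⟨C, hC⟩ hg0 hg0' => ?_⟩
    refine FluidEq.of_compactSupport h.finite h.continuousOn hne ht (fun f hf hfd hf0 hf0' => ?_)
      hg (fun x => (hC x).1) (fun x => (hC x).2) hg0 hg0'
    obtain ⟨φ, ⟨C, hC⟩, hlim, hlim'⟩ := S.hVdense f hf hfd hf0 hf0'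
    exact FluidEq.of_tendsto h.finite h.continuousOn hne ht (fun j => S.hVdiff (φ j))
      (fun j x => (hC j x).1) (fun j x => (hC j x).2) hlim hlim'
      fun j => h.fluidEq_V hne ht (φ j)

end Setting.FluidLimit

end PSQ

open PSQ MeasureTheory in
/-- Lemma 4.3: elements of B_L are fluid model solutions, with uniform
moment bounds and constant workload. -/
theorem stmt_12 (S : PSQ.Setting) :
    ∃ q : ℝ, q ∈ Set.Ioo 0 S.p ∧ ∃ Mq : ℝ, 1 < Mq ∧
      ∀ L : ℝ, 1 < L → ∀ ζ : ℝ → Measure ℝ, S.memBL L ζ →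
        (∀ t ∈ Set.Icc (0:ℝ) L,
          max (max (mass (ζ t)) (pair id (ζ t)))
            (pair (fun x => x ^ ((1:ℝ)+q)) (ζ t)) ≤ Mq) ∧
        (∀ t ∈ Set.Icc (0:ℝ) L, pair id (ζ t) = pair id (ζ 0)) ∧
        IsFluidSol S.α S.ν L ζ := by
  have hp := S.hp
  have hM := S.hM
  refine ⟨S.p / 2, ⟨by linarith, by linarith⟩, 2 * S.M, by linarith, fun L hL ζ hζ => ?_⟩
  obtain ⟨ξ, h⟩ := hζ.exists_fluidLimit hL
  refine ⟨fun t ht => max_le (max_le ?_ ?_) ?_, fun t ht => h.pair_id_eq ht hL, h.isFluidSol hL⟩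
  · linarith [h.mass_le ht]
  · linarith [(h.integrable_id ht).2]
  · exact h.pair_rpow_le ht (by linarith) (by linarith)
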